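/- arXiv:1610.05542 — 2 statements merged into one kernel-verified Lean document; each statement's English description precedes it below -/
import Mathlib

section
/- Let m > 0 and T > 0, and let x₊ < 0 be such that A'(x) < 0 for all x ∈ [x₊, 0) and F(r)/(4l²) − F'(r)²/16 ≥ 0 for all r ≥ r(x₊). Then there exist h₀ > 0, C > 0 and c > 0 such that for all h ∈ (0, h₀), all E ∈ ℝ with E ≤ 1/l² + T h, and all φ ∈ C_c^∞((x₊, 0), ℂ⁴): ‖e^{x²/(c h)} φ‖_{L²((x₊,0))} ≤ C ( ‖φ‖_{L²((x₊,0))} + h^{−1} ‖e^{x²/(c h)} ( −h² φ'' + V φ − E φ )‖_{L²((x₊,0))} ). -/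
open MeasureTheory Set Matrix

/-- The metric coefficient `F(r) = 1 - 2M/r + r²/l²`. -/
noncomputable def F (M l r : ℝ) : ℝ := 1 - 2*M/r + r^2/l^2

/-- The derivative `F'(r) = 2M/r² + 2r/l²`. -/
noncomputable def F' (M l r : ℝ) : ℝ := 2*M/r^2 + 2*r/l^2

/-- The potential `A(x) = F(r(x))^{1/2}/r(x)`. -/
noncomputable def A (M l : ℝ) (rfun : ℝ → ℝ) (x : ℝ) : ℝ :=
  Real.sqrt (F M l (rfun x)) / rfun x

/-- The potential `B(x) = F(r(x))^{1/2}`. -/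
noncomputable def B (M l : ℝ) (rfun : ℝ → ℝ) (x : ℝ) : ℝ :=
  Real.sqrt (F M l (rfun x))

/-- The Dirac matrix `γ¹`. -/
noncomputable def γ1 : Matrix (Fin 4) (Fin 4) ℂ :=
  !![0, 0, Complex.I, 0;
     0, 0, 0, -Complex.I;
     Complex.I, 0, 0, 0;
     0, -Complex.I, 0, 0]

/-- The matrix `γ¹γ²`. -/
noncomputable def γ12 : Matrix (Fin 4) (Fin 4) ℂ :=
  !![0, -1, 0, 0;
     1, 0, 0, 0;
     0, 0, 0, -1;
     0, 0, 1, 0]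

/-- The matrix potential
`V(x) = (A² + h²m²B²) I − ih A' γ¹γ² + ih² m B' γ¹`. -/
noncomputable def Vpot (M l : ℝ) (rfun : ℝ → ℝ) (m h x : ℝ) :
    Matrix (Fin 4) (Fin 4) ℂ :=
  (((A M l rfun x)^2 + h^2 * m^2 * (B M l rfun x)^2 : ℝ) : ℂ) • 1
    - (Complex.I * ((h * deriv (A M l rfun) x : ℝ) : ℂ)) • γ12
    + (Complex.I * ((h^2 * m * deriv (B M l rfun) x : ℝ) : ℂ)) • γ1

/-- The squared Hermitian norm `‖u‖² = ∑ |uⱼ|²` on `ℂ⁴`. -/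
noncomputable def nsq (u : Fin 4 → ℂ) : ℝ :=
  ∑ j, Complex.normSq (u j)

/-- The `L²` norm over a set `s ⊆ ℝ` of a `ℂ⁴`-valued function. -/
noncomputable def L2norm (s : Set ℝ) (g : ℝ → Fin 4 → ℂ) : ℝ :=
  Real.sqrt (∫ x in s, nsq (g x))

open Topology Filter

/-- A function continuous on an open interval and vanishing off a compact subset is integrable. -/
lemma agmon_integrable {a b : ℝ} {K : Set ℝ} (hK : IsCompact K) (hKs : K ⊆ Ioo a b)
    {g : ℝ → ℝ} (hg : ContinuousOn g (Ioo a b)) (h0 : ∀ x, x ∉ K → g x = 0) :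
    IntegrableOn g (Ioo a b) := by
  have h1 : IntegrableOn g K := (hg.mono hKs).integrableOn_compact hK
  have h2 : Integrable g :=
    (integrableOn_iff_integrable_of_support_subset (by
      intro x hx; by_contra h; exact hx (h0 x h))).1 h1
  exact h2.integrableOn

lemma agmon_hardy {a b : ℝ} (p : ℝ → ℝ) (hp : ContDiff ℝ (⊤ : ℕ∞) p)
    {K : Set ℝ} (hK : IsCompact K) (hKs : K ⊆ Ioo a 0) (h0 : ∀ x, x ∉ K → p x = 0) :
    IntegrableOn (fun x => Real.exp (b*x^2) *
      (p x * deriv (deriv p) x + p x^2 * (1/(4*x^2) - b^2*x^2))) (Ioo a 0) ∧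
    ∫ x in Ioo a 0, Real.exp (b*x^2) *
      (p x * deriv (deriv p) x + p x^2 * (1/(4*x^2) - b^2*x^2)) ≤ 0 := by
  have hpd : Differentiable ℝ p := hp.differentiable (by simp)
  have hp1 : ContDiff ℝ (⊤ : ℕ∞) (deriv p) := by
    have := (contDiff_infty_iff_deriv (𝕜 := ℝ) (f := p)).1 hp
    exact this.2
  have hp1d : Differentiable ℝ (deriv p) := hp1.differentiable (by simp)
  have hp2 : Continuous (deriv (deriv p)) :=
    ((contDiff_infty_iff_deriv (𝕜 := ℝ) (f := deriv p)).1 hp1).2.continuous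
  set S : ℝ → ℝ := fun x => Real.exp (b*x^2) *
      (p x * deriv (deriv p) x + p x^2 * (1/(4*x^2) - b^2*x^2)) with hS
  have hSint : IntegrableOn S (Ioo a 0) := by
    refine agmon_integrable hK hKs ?_ (fun x hx => by simp [hS, h0 x hx])
    have hne : ∀ x ∈ Ioo a (0:ℝ), 4*x^2 ≠ 0 := fun x hx => by
      have := hx.2.ne; positivity
    have hc := hp.continuous
    refine ContinuousOn.mul (by fun_prop) (ContinuousOn.add (by fun_prop) (ContinuousOn.mul (by fun_prop)
      (ContinuousOn.sub (ContinuousOn.div (by fun_prop) (by fun_prop) hne) (by fun_prop))))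
  refine ⟨hSint, ?_⟩
  -- the total derivative
  set W : ℝ → ℝ := fun x => Real.exp (b*x^2) * (deriv p x * p x - p x^2/(2*x)) with hW
  have hW0 : ∀ x, x ∉ K → W x = 0 := fun x hx => by simp [hW, h0 x hx]
  have hWK : HasCompactSupport W := HasCompactSupport.intro hK hW0
  have h0K : (0:ℝ) ∉ K := fun h => lt_irrefl _ (hKs h).2
  have hWev : ∀ x, x ∉ K → W =ᶠ[𝓝 x] fun _ => 0 := fun x hx => by
    filter_upwards [hK.isClosed.isOpen_compl.mem_nhds hx] with y hy using hW0 y hy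
  have hWsm : ContDiff ℝ 1 W := by
    rw [contDiff_iff_contDiffAt]
    intro x
    by_cases hx : x ∈ K
    · have hx0 : 2*x ≠ 0 := by have := (hKs hx).2.ne; positivity
      have e1 : ContDiff ℝ 1 p := hp.of_le (by exact_mod_cast le_top)
      have e2 : ContDiff ℝ 1 (deriv p) := hp1.of_le (by exact_mod_cast le_top)
      refine ContDiffAt.mul (by fun_prop) (ContDiffAt.sub (by fun_prop) (ContDiffAt.div (by fun_prop) (by fun_prop) hx0))
    · exact contDiffAt_const.congr_of_eventuallyEq (hWev x hx)
  have hWd : ∀ x, HasDerivAt W (deriv W x) x := fun x =>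
    (hWsm.differentiable (by simp) x).hasDerivAt
  have hWdc : Continuous (deriv W) := hWsm.continuous_deriv (by simp)
  have hWdi : Integrable (deriv W) := hWdc.integrable_of_hasCompactSupport hWK.deriv
  have hWi : Integrable W := hWsm.continuous.integrable_of_hasCompactSupport hWK
  have hz : ∫ x, deriv W x = 0 :=
    integral_eq_zero_of_hasDerivAt_of_integrable hWd hWdi hWi
  have hz' : ∫ x in Ioo a 0, deriv W x = 0 := by
    rw [setIntegral_eq_integral_of_forall_compl_eq_zero, hz]
    intro x hx
    have hx' : x ∉ K := fun h => hx (hKs h)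
    rw [(hWev x hx').deriv_eq]; simp
  refine le_trans ?_ hz'.le
  refine setIntegral_mono_on hSint hWdi.integrableOn measurableSet_Ioo ?_
  intro x hx
  have hx0 : x ≠ 0 := hx.2.ne
  have hd : HasDerivAt W (Real.exp (b*x^2) * (b*(2*x)) * (deriv p x * p x - p x^2/(2*x))
      + Real.exp (b*x^2) * (deriv (deriv p) x * p x + deriv p x * deriv p x
        - ((2 * p x * deriv p x) * (2*x) - p x^2 * 2)/(2*x)^2)) x := by
    have d1 : HasDerivAt (fun x : ℝ => Real.exp (b*x^2)) (Real.exp (b*x^2) * (b*(2*x))) x := by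
      have : HasDerivAt (fun x : ℝ => b*x^2) (b*(2*x)) x := by
        simpa using (hasDerivAt_pow 2 x).const_mul b
      exact this.exp
    have d2 := (hpd x).hasDerivAt
    have d3 := (hp1d x).hasDerivAt
    have d4 : HasDerivAt (fun x : ℝ => 2*x) 2 x := by
      simpa using (hasDerivAt_id x).const_mul (2:ℝ)
    have d5 : HasDerivAt (fun x => p x^2) (2 * p x * deriv p x) x := by
      simpa using d2.fun_pow 2
    exact d1.mul ((d3.mul d2).sub (d5.div d4 (by positivity)))
  rw [hd.deriv]
  have key : Real.exp (b*x^2) * (b*(2*x)) * (deriv p x * p x - p x^2/(2*x))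
      + Real.exp (b*x^2) * (deriv (deriv p) x * p x + deriv p x * deriv p x
        - ((2 * p x * deriv p x) * (2*x) - p x^2 * 2)/(2*x)^2) - S x
      = Real.exp (b*x^2) * (deriv p x + b*x*p x - p x/(2*x))^2 := by
    simp only [hS]; field_simp; ring
  have : 0 ≤ Real.exp (b*x^2) * (deriv p x + b*x*p x - p x/(2*x))^2 := by positivity
  linarith

lemma agmon_quad_aux (s t1 t2 : ℝ) (u : Fin 4 → ℂ) :
    ∑ j, ((u j).re * ((((s : ℂ) • (1 : Matrix (Fin 4) (Fin 4) ℂ) - (Complex.I * (t1 : ℂ)) • γ12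
        + (Complex.I * (t2 : ℂ)) • γ1) *ᵥ u) j).re
      + (u j).im * ((((s : ℂ) • (1 : Matrix (Fin 4) (Fin 4) ℂ) - (Complex.I * (t1 : ℂ)) • γ12
        + (Complex.I * (t2 : ℂ)) • γ1) *ᵥ u) j).im) =
     s * nsq u
      + (-t1 * (2*((u 0).re*(u 1).im - (u 0).im*(u 1).re)
        + 2*((u 2).re*(u 3).im - (u 2).im*(u 3).re)))
      + (t2 * (2*((u 1).re*(u 3).re + (u 1).im*(u 3).im)
        - 2*((u 0).re*(u 2).re + (u 0).im*(u 2).im))) := by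
  simp only [nsq, γ12, γ1, Fin.sum_univ_four, Matrix.mulVec, dotProduct,
    Matrix.add_apply, Matrix.sub_apply, Matrix.smul_apply, Matrix.one_apply,
    Complex.normSq_apply]
  simp [Complex.add_re, Complex.mul_re, Complex.mul_im]
  ring

/-- Quadratic form lower bound for the matrix potential. -/
lemma agmon_quad (M l : ℝ) (rfun : ℝ → ℝ) (m h x : ℝ) (hh : 0 < h) (hm : 0 < m)
    (u : Fin 4 → ℂ) :
    ((A M l rfun x)^2 + h^2 * m^2 * (B M l rfun x)^2 - h * |deriv (A M l rfun) x|
      - h^2 * m * |deriv (B M l rfun) x|) * nsq u ≤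
    ∑ j, ((u j).re * ((Vpot M l rfun m h x *ᵥ u) j).re
      + (u j).im * ((Vpot M l rfun m h x *ᵥ u) j).im) := by
  generalize hA : deriv (A M l rfun) x = a
  generalize hB : deriv (B M l rfun) x = b
  have e : ∑ j, ((u j).re * ((Vpot M l rfun m h x *ᵥ u) j).re
      + (u j).im * ((Vpot M l rfun m h x *ᵥ u) j).im) =
     ((A M l rfun x)^2 + h^2 * m^2 * (B M l rfun x)^2) * nsq u
      + h * (-a * (2*((u 0).re*(u 1).im - (u 0).im*(u 1).re)
        + 2*((u 2).re*(u 3).im - (u 2).im*(u 3).re)))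
      + h^2 * m * (b * (2*((u 1).re*(u 3).re + (u 1).im*(u 3).im)
        - 2*((u 0).re*(u 2).re + (u 0).im*(u 2).im))) := by
    unfold Vpot
    rw [hA, hB, agmon_quad_aux]
    ring
  rw [e]
  have hn : nsq u = (u 0).re^2 + (u 0).im^2 + (u 1).re^2 + (u 1).im^2
      + (u 2).re^2 + (u 2).im^2 + (u 3).re^2 + (u 3).im^2 := by
    simp only [nsq, Fin.sum_univ_four, Complex.normSq_apply]; ring
  have gen : ∀ a q n : ℝ, |q| ≤ n → -(|a| * n) ≤ a * q := by
    intro a q n hq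
    have : |a*q| ≤ |a| * n := by rw [abs_mul]; gcongr
    exact (abs_le.1 this).1
  have q1 := gen (-a) (2*((u 0).re*(u 1).im - (u 0).im*(u 1).re)
        + 2*((u 2).re*(u 3).im - (u 2).im*(u 3).re)) (nsq u) (by
      rw [hn, abs_le]; constructor
      · nlinarith [sq_nonneg ((u 0).re+(u 1).im), sq_nonneg ((u 0).im-(u 1).re), sq_nonneg ((u 2).re+(u 3).im), sq_nonneg ((u 2).im-(u 3).re)]
      · nlinarith [sq_nonneg ((u 0).re-(u 1).im), sq_nonneg ((u 0).im+(u 1).re), sq_nonneg ((u 2).re-(u 3).im), sq_nonneg ((u 2).im+(u 3).re)])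
  have q2 := gen b (2*((u 1).re*(u 3).re + (u 1).im*(u 3).im)
        - 2*((u 0).re*(u 2).re + (u 0).im*(u 2).im)) (nsq u) (by
      rw [hn, abs_le]; constructor
      · nlinarith [sq_nonneg ((u 1).re+(u 3).re), sq_nonneg ((u 1).im+(u 3).im), sq_nonneg ((u 0).re-(u 2).re), sq_nonneg ((u 0).im-(u 2).im)]
      · nlinarith [sq_nonneg ((u 1).re-(u 3).re), sq_nonneg ((u 1).im-(u 3).im), sq_nonneg ((u 0).re+(u 2).re), sq_nonneg ((u 0).im+(u 2).im)])
  rw [abs_neg] at q1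
  have q1' := mul_le_mul_of_nonneg_left q1 hh.le
  have q2' := mul_le_mul_of_nonneg_left q2 (by positivity : 0 ≤ h^2*m)
  linarith

lemma agmon_F_hasDerivAt (M l r : ℝ) (hr : 0 < r) (hl : 0 < l) :
    HasDerivAt (F M l) (F' M l r) r := by
  have d1 : HasDerivAt (fun r : ℝ => 2*M/r) (-(2*M)/r^2) r := by
    exact ((hasDerivAt_inv hr.ne').const_mul (2*M)).congr_deriv (by ring)
  have d2 : HasDerivAt (fun r : ℝ => r^2/l^2) (2*r/l^2) r := by
    simpa using (hasDerivAt_pow 2 r).div_const (l^2)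
  have := ((hasDerivAt_const r (1:ℝ)).sub d1).add d2
  exact this.congr_deriv (by unfold F'; ring)

/-- The derivative of the radius is given by the metric coefficient. -/
lemma agmon_r_deriv (M l : ℝ) (hl : 0 < l)
    (rSAdS : ℝ) (hrS : 0 < rSAdS)
    (hFpos : ∀ r, rSAdS < r → 0 < F M l r)
    (rfun : ℝ → ℝ)
    (hrange : ∀ x, x < 0 → rSAdS < rfun x)
    (hinv1 : ∀ x, x < 0 → -(∫ s in Set.Ioi (rfun x), (F M l s)⁻¹) = x)
    (hinv2 : ∀ r, rSAdS < r → rfun (-(∫ s in Set.Ioi r, (F M l s)⁻¹)) = r)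
    (x : ℝ) (hx : x < 0) :
    IntegrableOn (fun s => (F M l s)⁻¹) (Ioi (rfun x)) ∧
    HasDerivAt rfun (F M l (rfun x)) x := by
  have hintegr : IntegrableOn (fun s => (F M l s)⁻¹) (Ioi (rfun x)) := by
    by_contra h
    have := hinv1 x hx
    rw [integral_undef h] at this
    simp at this; exact hx.ne this.symm
  refine ⟨hintegr, ?_⟩
  set r0 := rfun x with hr0
  have hr := hrange x hx
  have hcont : ContinuousOn (fun s => (F M l s)⁻¹) (Ioi rSAdS) := by
    intro s hs
    exact ((agmon_F_hasDerivAt M l s (hrS.trans hs) hl).continuousAt.inv₀ (hFpos s hs).ne').continuousWithinAt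
  have hd1 : HasStrictDerivAt (fun u => ∫ s in u..r0, (F M l s)⁻¹) (-(F M l r0)⁻¹) r0 := by
    refine intervalIntegral.integral_hasStrictDerivAt_left (by simp) ?_ (hcont.continuousAt (Ioi_mem_nhds hr))
    exact hcont.stronglyMeasurableAtFilter isOpen_Ioi r0 hr
  have hd2 : HasStrictDerivAt (fun u => -((∫ s in u..r0, (F M l s)⁻¹) + ∫ s in Ioi r0, (F M l s)⁻¹))
      ((F M l r0)⁻¹) r0 := by
    have := (hd1.add_const (∫ s in Ioi r0, (F M l s)⁻¹)).fun_neg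
    rwa [neg_neg] at this
  have h3 := hd2.to_local_left_inverse (inv_ne_zero (hFpos _ hr).ne') (g := rfun) (by
    filter_upwards [Ioi_mem_nhds hr] with u hu
    rw [intervalIntegral.integral_interval_add_Ioi' _ hintegr]
    · exact hinv2 u hu
    · refine (hcont.mono ?_).intervalIntegrable
      intro y hy
      exact lt_of_lt_of_le (lt_min hu hr) hy.1)
  have e := hinv1 x hx
  simp only [intervalIntegral.integral_same, zero_add, inv_inv] at h3
  rw [← hr0] at e
  rw [e] at h3
  exact h3.hasDerivAt

set_option maxHeartbeats 1000000 in
/-- All pointwise information on the potentials near the conformal boundary. -/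
lemma agmon_pot (M l : ℝ) (hM : 0 < M) (hl : 0 < l)
    (rSAdS : ℝ) (hrS : 0 < rSAdS)
    (hFpos : ∀ r, rSAdS < r → 0 < F M l r)
    (rfun : ℝ → ℝ)
    (hrange : ∀ x, x < 0 → rSAdS < rfun x)
    (hinv1 : ∀ x, x < 0 → -(∫ s in Set.Ioi (rfun x), (F M l s)⁻¹) = x)
    (hinv2 : ∀ r, rSAdS < r → rfun (-(∫ s in Set.Ioi r, (F M l s)⁻¹)) = r)
    (m : ℝ) (hm : 0 < m)
    (xp : ℝ) (hxp : xp < 0)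
    (hA' : ∀ x, xp ≤ x → x < 0 → deriv (A M l rfun) x < 0)
    (hcond : ∀ r, rfun xp ≤ r → 0 ≤ F M l r / (4*l^2) - (F' M l r)^2 / 16)
    (x : ℝ) (hx : x ∈ Ioo xp 0) :
    1/l^2 + x^2/(3*l^4) ≤ (A M l rfun x)^2 ∧
    |deriv (A M l rfun) x| ≤ 1 + 1/(9*M^2*l^2) + 1/(81*M^4) ∧
    -(1/(4*x^2)) - 1/(4*l^2) ≤ m^2*(B M l rfun x)^2 - m*|deriv (B M l rfun) x| := by
  obtain ⟨hx1, hx2⟩ := hx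
  have hder := fun y hy => (agmon_r_deriv M l hl rSAdS hrS hFpos rfun hrange hinv1 hinv2 y hy).2
  have hintegr := (agmon_r_deriv M l hl rSAdS hrS hFpos rfun hrange hinv1 hinv2 x hx2).1
  have hmono : StrictMonoOn rfun (Iio 0) := by
    refine strictMonoOn_of_deriv_pos (convex_Iio 0)
      (fun y hy => (hder y hy).continuousAt.continuousWithinAt) ?_
    intro y hy
    rw [interior_Iio] at hy
    rw [(hder y hy).deriv]
    exact hFpos _ (hrange y hy)
  have hge : rfun xp ≤ rfun x := (hmono hxp hx2 hx1).le
  have hc := hcond _ hge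
  have hdr := hder x hx2
  have hrr := hrange x hx2
  have hA1 := hA' x hx1.le hx2
  have hi := hinv1 x hx2
  set r := rfun x with hrdef
  have hr : 0 < r := hrS.trans hrr
  have hF := hFpos r hrr
  have hdF : HasDerivAt (fun y => F M l (rfun y)) (F' M l r * F M l r) x :=
    (agmon_F_hasDerivAt M l r hr hl).comp x hdr
  have hdB : HasDerivAt (B M l rfun) (F' M l r * F M l r / (2 * √(F M l r))) x :=
    hdF.sqrt hF.ne'
  have hs : 0 < √(F M l r) := Real.sqrt_pos.2 hF
  have hss : √(F M l r) * √(F M l r) = F M l r := Real.mul_self_sqrt hF.le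
  have hss2 : √(F M l r) ^2 = F M l r := Real.sq_sqrt hF.le
  have hdB' : deriv (B M l rfun) x = F' M l r * √(F M l r) / 2 := by
    rw [hdB.deriv]
    rw [div_eq_div_iff (by positivity) (by norm_num)]
    linear_combination (-2 * F' M l r) * hss
  have hdA : HasDerivAt (A M l rfun)
      ((F' M l r * F M l r / (2 * √(F M l r)) * r - √(F M l r) * F M l r) / r^2) x :=
    hdB.div hdr hr.ne'
  have hdA' : deriv (A M l rfun) x = √(F M l r) * (3*M/r - 1) / r^2 := by
    rw [hdA.deriv, ← hdB.deriv, hdB']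
    have : F' M l r * r / 2 - F M l r = 3*M/r - 1 := by
      unfold F F'; field_simp; ring
    rw [← this]; ring
  have h3M : 3*M < r := by
    rw [hdA'] at hA1
    by_contra hcon
    push Not at hcon
    have : 1 ≤ 3*M/r := by rw [le_div_iff₀ hr]; linarith
    have : 0 ≤ √(F M l r) * (3*M/r - 1) / r^2 := by
      have : 0 ≤ 3*M/r - 1 := by linarith
      positivity
    linarith
  -- |x| r ≤ l²
  have hxr : -x * r ≤ l^2 := by
    have hle : ∫ s in Ioi r, (F M l s)⁻¹ ≤ ∫ s in Ioi r, l^2 * s^(-2:ℝ) := by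
      refine setIntegral_mono_on hintegr
        ((integrableOn_Ioi_rpow_of_lt (by norm_num) hr).const_mul _) measurableSet_Ioi ?_
      intro s hs
      have hs' : r < s := hs
      have hs0 : 0 < s := hr.trans hs'
      rw [Real.rpow_neg hs0.le, Real.rpow_two, ← div_eq_mul_inv, ← inv_div]
      apply inv_anti₀ (by positivity)
      unfold F
      have : 2*M/s ≤ 1 := by rw [div_le_one hs0]; linarith
      linarith
    rw [integral_const_mul, integral_Ioi_rpow_of_lt (by norm_num) hr] at hle
    norm_num at hle
    rw [Real.rpow_neg_one] at hle
    have : -x ≤ l^2 * r⁻¹ := by rw [← hi]; linarith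
    calc -x * r ≤ l^2 * r⁻¹ * r := by gcongr
      _ = l^2 := by field_simp
  have hxr2 : x^2 * r^2 ≤ l^4 := by
    have : 0 ≤ -x * r := mul_nonneg (by linarith) hr.le
    nlinarith
  have hMr : 2*M/r ≤ 2/3 := by rw [div_le_iff₀ hr]; linarith
  have hMr0 : 0 < 2*M/r := by positivity
  have hx20 : 0 < x^2 := by have := hx2.ne; positivity
  refine ⟨?_, ?_, ?_⟩
  · have : (A M l rfun x)^2 = F M l r / r^2 := by
      unfold A; rw [div_pow, ← hrdef, hss2]
    rw [this]
    have h1 : 1/l^2 + 1/(3*r^2) ≤ F M l r / r^2 := by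
      have : F M l r / r^2 = 1/l^2 + (1 - 2*M/r)/r^2 := by unfold F; field_simp; ring
      rw [this]
      have : 1/(3*r^2) = (1/3)/r^2 := by field_simp
      rw [this]; gcongr; linarith
    have h2 : x^2/(3*l^4) ≤ 1/(3*r^2) := by
      rw [div_le_div_iff₀ (by positivity) (by positivity)]; linarith
    linarith
  · rw [hdA']
    have h1 : |√(F M l r) * (3*M/r - 1) / r^2| ≤ √(F M l r) / r^2 := by
      rw [abs_div, abs_mul, abs_of_pos hs, abs_of_pos (by positivity : 0 < r^2)]
      gcongr
      have h3 : 3*M/r ≤ 1 := by rw [div_le_one hr]; linarith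
      have : 0 < 3*M/r := by positivity
      have : |3*M/r - 1| ≤ 1 := by rw [abs_le]; constructor <;> linarith
      nlinarith
    refine h1.trans ?_
    have h4 : (√(F M l r) / r^2)^2 ≤ 1/(9*M^2*l^2) + 1/(81*M^4) := by
      rw [div_pow, hss2]
      have e1 : F M l r ≤ 1 + r^2/l^2 := by unfold F; linarith
      have hr2 : 9*M^2 ≤ r^2 := by nlinarith
      calc F M l r / (r^2)^2 ≤ (1 + r^2/l^2) / (r^2)^2 := by gcongr
        _ = 1/(r^2*l^2) + 1/(r^2)^2 := by field_simp; ring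
        _ ≤ 1/(9*M^2*l^2) + 1/(9*M^2)^2 := by gcongr
        _ = _ := by ring
    nlinarith [sq_nonneg (√(F M l r) / r^2 - 1), sq_nonneg (√(F M l r) / r^2)]
  · have hB2 : (B M l rfun x)^2 = F M l r := by unfold B; rw [← hrdef, hss2]
    have hFp : 0 < F' M l r := by unfold F'; positivity
    rw [hB2, hdB', abs_of_pos (by positivity)]
    have h1 : F M l r / (4*l^2) ≤ 1/(4*x^2) + 1/(4*l^2) := by
      have e1 : F M l r ≤ 1 + r^2/l^2 := by unfold F; linarith
      have e2 : r^2/(4*l^4) ≤ 1/(4*x^2) := by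
        rw [div_le_div_iff₀ (by positivity) (by positivity)]; linarith
      calc F M l r / (4*l^2) ≤ (1 + r^2/l^2)/(4*l^2) := by gcongr
        _ = r^2/(4*l^4) + 1/(4*l^2) := by field_simp; ring
        _ ≤ _ := by linarith
    nlinarith [sq_nonneg (m * √(F M l r) - F' M l r / 4)]

lemma agmon_comp_deriv (L : (Fin 4 → ℂ) →L[ℝ] ℝ) (φ : ℝ → Fin 4 → ℂ)
    (hφ : ContDiff ℝ (⊤ : ℕ∞) φ) :
    deriv (deriv (fun x => L (φ x))) = fun x => L (deriv (deriv φ) x) := by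
  have gen : ∀ ψ : ℝ → Fin 4 → ℂ, Differentiable ℝ ψ →
      deriv (fun x => L (ψ x)) = fun x => L (deriv ψ x) := by
    intro ψ hψ
    funext x
    exact (L.hasFDerivAt.comp_hasDerivAt x (hψ x).hasDerivAt).deriv
  have h1 : ContDiff ℝ (⊤ : ℕ∞) (deriv φ) :=
    ((contDiff_infty_iff_deriv (𝕜 := ℝ) (f := φ)).1 hφ).2
  rw [gen φ (hφ.differentiable (by simp)), gen _ (h1.differentiable (by simp))]

lemma agmon_nsq_smul (t : ℝ) (u : Fin 4 → ℂ) : nsq ((t : ℂ) • u) = t^2 * nsq u := by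
  simp only [nsq, Pi.smul_apply, smul_eq_mul, Complex.normSq_mul, Complex.normSq_ofReal,
    Finset.mul_sum, pow_two]

lemma agmon_nsq_nonneg (u : Fin 4 → ℂ) : 0 ≤ nsq u :=
  Finset.sum_nonneg fun j _ => Complex.normSq_nonneg _

lemma agmon_nsq_cont : Continuous nsq := by
  unfold nsq
  exact continuous_finsetSum _ fun j _ => Complex.continuous_normSq.comp (continuous_apply j)

/-- real inner product -/
noncomputable def agmonIp (u v : Fin 4 → ℂ) : ℝ := ∑ j, ((u j).re * (v j).re + (u j).im * (v j).im)

lemma agmon_ip_le (h : ℝ) (hh : 0 < h) (u v : Fin 4 → ℂ) :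
    agmonIp u v ≤ h/2 * nsq u + 1/(2*h) * nsq v := by
  unfold agmonIp nsq
  rw [Finset.mul_sum, Finset.mul_sum, ← Finset.sum_add_distrib]
  refine Finset.sum_le_sum fun j _ => ?_
  have gen : ∀ a b : ℝ, a * b ≤ h/2 * (a*a) + 1/(2*h) * (b*b) := by
    intro a b
    have : h/2 * (a*a) + 1/(2*h) * (b*b) - a*b = 1/(2*h) * (h*a - b)^2 := by
      field_simp; ring
    have : 0 ≤ 1/(2*h) * (h*a - b)^2 := by positivity
    linarith
  rw [Complex.normSq_apply, Complex.normSq_apply]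
  linarith [gen (u j).re (v j).re, gen (u j).im (v j).im]

lemma agmon_scalar (l C1 h x : ℝ) (hl : 0 < l) (hC : 0 < C1) (hh : 0 < h) :
    h * Real.exp (2/(5*l^2*h)*x^2) ≤ Real.exp (2/(5*l^2*h)*x^2) * (x^2/(6*l^4) - C1*h)
      + h * ((C1+1) * Real.exp (2*(6*l^4*(C1+1))/(5*l^2))) := by
  set K := 6*l^4*(C1+1) with hK
  by_cases hx : K*h ≤ x^2
  · have h1 : (C1+1)*h ≤ x^2/(6*l^4) := by
      rw [le_div_iff₀ (by positivity)]; linarith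
    have h2 : 0 < Real.exp (2/(5*l^2*h)*x^2) := Real.exp_pos _
    have h3 : 0 ≤ h * ((C1+1) * Real.exp (2*K/(5*l^2))) := by positivity
    nlinarith
  · push Not at hx
    have h1 : Real.exp (2/(5*l^2*h)*x^2) ≤ Real.exp (2*K/(5*l^2)) := by
      apply Real.exp_le_exp.2
      calc 2/(5*l^2*h)*x^2 ≤ 2/(5*l^2*h)*(K*h) := by gcongr
        _ = 2*K/(5*l^2) := by field_simp
    have h2 : 0 < Real.exp (2/(5*l^2*h)*x^2) := Real.exp_pos _
    have h3 : 0 ≤ Real.exp (2/(5*l^2*h)*x^2) * (x^2/(6*l^4)) := by positivity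
    have h4 := mul_le_mul_of_nonneg_left h1 (by positivity : 0 ≤ h*(C1+1))
    nlinarith

lemma agmon_final (D h I0 I1 I2 : ℝ) (hD : 0 < D) (hh : 0 < h) (h0 : 0 ≤ I0) (h2 : 0 ≤ I2)
    (hI : h/2 * I1 ≤ h*D * I0 + 1/(2*h) * I2) :
    √I1 ≤ (2*D+1) * (√I0 + h⁻¹ * √I2) := by
  have h1 : I1 ≤ 2*D*I0 + (h⁻¹)^2 * I2 := by
    have := mul_le_mul_of_nonneg_left hI (by positivity : 0 ≤ 2*h⁻¹)
    have e1 : 2*h⁻¹ * (h/2 * I1) = I1 := by field_simp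
    have e2 : 2*h⁻¹ * (h*D * I0 + 1/(2*h) * I2) = 2*D*I0 + (h⁻¹)^2 * I2 := by field_simp
    linarith
  apply Real.sqrt_le_iff.2
  have hi : 0 < h⁻¹ := by positivity
  refine ⟨by positivity, h1.trans ?_⟩
  have s0 := Real.sq_sqrt h0
  have s2 := Real.sq_sqrt h2
  have n0 := Real.sqrt_nonneg I0
  have n2 := mul_nonneg hi.le (Real.sqrt_nonneg I2)
  have e : (h⁻¹)^2 * I2 = (h⁻¹ * √I2)^2 := by rw [mul_pow, s2]
  rw [e, ← s0, Real.sqrt_sq n0]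
  generalize h⁻¹ * √I2 = b at *
  generalize √I0 = a at *
  have : (2*D+1)^2 = 1 + 4*D + 4*D^2 := by ring
  rw [mul_pow, this]
  have p1 : 0 ≤ a*b := mul_nonneg n0 n2
  have p2 : a^2 + b^2 ≤ (a+b)^2 := by nlinarith
  have p3 : 0 ≤ D * b^2 := by positivity
  have p4 : 0 ≤ D * a^2 := by positivity
  have p5 : (1+4*D+4*D^2) * (a^2+b^2) ≤ (1+4*D+4*D^2) * (a+b)^2 := by gcongr
  have p6 : 0 ≤ D^2 * (a^2+b^2) := by positivity
  nlinarith [sq_nonneg a]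

set_option maxHeartbeats 1000000 in
/-- Agmon estimate: there are `h₀, C, c > 0` such that for `0 < h < h₀`,
`E ≤ 1/l² + Th` and every `φ ∈ C_c^∞((x₊,0),ℂ⁴)`:
`‖e^{x²/(ch)}φ‖_{L²} ≤ C(‖φ‖_{L²} + h⁻¹‖e^{x²/(ch)}(−h²φ'' + Vφ − Eφ)‖_{L²})`. -/
theorem stmt_16 (M l : ℝ) (hM : 0 < M) (hl : 0 < l)
    (rSAdS : ℝ) (hrS : 0 < rSAdS) (hroot : F M l rSAdS = 0)
    (hFpos : ∀ r, rSAdS < r → 0 < F M l r)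
    (rfun : ℝ → ℝ)
    (hrange : ∀ x, x < 0 → rSAdS < rfun x)
    (hinv1 : ∀ x, x < 0 → -(∫ s in Set.Ioi (rfun x), (F M l s)⁻¹) = x)
    (hinv2 : ∀ r, rSAdS < r → rfun (-(∫ s in Set.Ioi r, (F M l s)⁻¹)) = r)
    (hAsm : ContDiffOn ℝ (⊤ : ℕ∞) (A M l rfun) (Set.Iio 0))
    (hBsm : ContDiffOn ℝ (⊤ : ℕ∞) (B M l rfun) (Set.Iio 0))
    (m T : ℝ) (hm : 0 < m) (hT : 0 < T)
    (xp : ℝ) (hxp : xp < 0)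
    (hA' : ∀ x, xp ≤ x → x < 0 → deriv (A M l rfun) x < 0)
    (hcond : ∀ r, rfun xp ≤ r → 0 ≤ F M l r / (4*l^2) - (F' M l r)^2 / 16) :
    ∃ h₀ > 0, ∃ C > 0, ∃ c > 0, ∀ h : ℝ, 0 < h → h < h₀ →
      ∀ E : ℝ, E ≤ 1/l^2 + T*h →
      ∀ φ : ℝ → Fin 4 → ℂ, ContDiff ℝ (⊤ : ℕ∞) φ → HasCompactSupport φ →
        tsupport φ ⊆ Set.Ioo xp 0 →
        L2norm (Set.Ioo xp 0)
            (fun x => ((Real.exp (x^2/(c*h)) : ℝ) : ℂ) • φ x)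
          ≤ C * (L2norm (Set.Ioo xp 0) φ
              + h⁻¹ * L2norm (Set.Ioo xp 0)
                  (fun x => ((Real.exp (x^2/(c*h)) : ℝ) : ℂ) •
                    ((-(h^2 : ℂ)) • deriv (deriv φ) x
                      + Vpot M l rfun m h x *ᵥ φ x
                      - ((E : ℝ) : ℂ) • φ x))) := by
  classical
  set KA := 1 + 1/(9*M^2*l^2) + 1/(81*M^4) with hKA
  have hKA0 : 0 < KA := by positivity
  set C1 := 1/(4*l^2) + KA + T with hC1
  have hC10 : 0 < C1 := by positivity
  set D := (C1+1) * Real.exp (2*(6*l^4*(C1+1))/(5*l^2)) with hD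
  have hD0 : 0 < D := by positivity
  refine ⟨1, one_pos, 2*D+1, by positivity, 5*l^2, by positivity, ?_⟩
  intro h hh hh1 E hE φ hφ hφc hφs
  set f : ℝ → Fin 4 → ℂ := fun x => (-(h^2 : ℂ)) • deriv (deriv φ) x
                      + Vpot M l rfun m h x *ᵥ φ x
                      - ((E : ℝ) : ℂ) • φ x with hf
  set b := 2/(5*l^2*h) with hb
  have hw : ∀ x : ℝ, Real.exp (x^2/(5*l^2*h))^2 = Real.exp (b*x^2) := by
    intro x
    rw [← Real.exp_nat_mul]; congr 1; rw [hb]; push_cast; ring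
  have hφ1 : ContDiff ℝ (⊤ : ℕ∞) (deriv φ) :=
    ((contDiff_infty_iff_deriv (𝕜 := ℝ) (f := φ)).1 hφ).2
  have hφ2 : Continuous (deriv (deriv φ)) :=
    ((contDiff_infty_iff_deriv (𝕜 := ℝ) (f := deriv φ)).1 hφ1).2.continuous
  have hK : IsCompact (tsupport φ) := hφc
  have hz0 : ∀ x, x ∉ tsupport φ → φ x = 0 := fun x hx => image_eq_zero_of_notMem_tsupport hx
  have hz2 : ∀ x, x ∉ tsupport φ → deriv (deriv φ) x = 0 := by
    intro x hx
    have e0 : φ =ᶠ[𝓝 x] fun _ => 0 := by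
      filter_upwards [(isClosed_tsupport φ).isOpen_compl.mem_nhds hx] with y hy using hz0 y hy
    have e1 := e0.deriv
    rw [e1.deriv_eq]; simp
  have hzf : ∀ x, x ∉ tsupport φ → f x = 0 := by
    intro x hx; simp [hf, hz0 x hx, hz2 x hx]
  have hsub : Ioo xp 0 ⊆ Iio (0:ℝ) := fun x hx => hx.2
  have hdAc : ContinuousOn (deriv (A M l rfun)) (Ioo xp 0) :=
    (hAsm.continuousOn_deriv_of_isOpen isOpen_Iio (by simp)).mono hsub
  have hdBc : ContinuousOn (deriv (B M l rfun)) (Ioo xp 0) :=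
    (hBsm.continuousOn_deriv_of_isOpen isOpen_Iio (by simp)).mono hsub
  have hAc : ContinuousOn (A M l rfun) (Ioo xp 0) := hAsm.continuousOn.mono hsub
  have hBc : ContinuousOn (B M l rfun) (Ioo xp 0) := hBsm.continuousOn.mono hsub
  have hφcont := hφ.continuous
  have hVc : ContinuousOn (fun x => Vpot M l rfun m h x) (Ioo xp 0) := by
    unfold Vpot
    refine ContinuousOn.fun_add (ContinuousOn.fun_sub (ContinuousOn.fun_smul ?_ continuousOn_const)
      (ContinuousOn.fun_smul ?_ continuousOn_const)) (ContinuousOn.fun_smul ?_ continuousOn_const)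
    · exact Complex.continuous_ofReal.comp_continuousOn (by fun_prop)
    · exact continuousOn_const.mul (Complex.continuous_ofReal.comp_continuousOn (by fun_prop))
    · exact continuousOn_const.mul (Complex.continuous_ofReal.comp_continuousOn (by fun_prop))
  have hfc : ContinuousOn f (Ioo xp 0) := by
    have h1 : ContinuousOn (fun x => Vpot M l rfun m h x *ᵥ φ x) (Ioo xp 0) :=
      (continuous_fst.matrix_mulVec continuous_snd).comp_continuousOn
        (hVc.prodMk hφcont.continuousOn)
    exact ((hφ2.fun_const_smul _).continuousOn.fun_add h1).fun_sub (hφcont.fun_const_smul _).continuousOn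
  have hn0 : nsq 0 = 0 := by simp [nsq]
  have i0 : IntegrableOn (fun x => nsq (φ x)) (Ioo xp 0) :=
    agmon_integrable hK hφs (agmon_nsq_cont.comp hφcont).continuousOn
      (fun x hx => by rw [hz0 x hx, hn0])
  have i1 : IntegrableOn (fun x => Real.exp (b*x^2) * nsq (φ x)) (Ioo xp 0) :=
    agmon_integrable hK hφs
      (ContinuousOn.mul (by fun_prop) (agmon_nsq_cont.comp hφcont).continuousOn)
      (fun x hx => by rw [hz0 x hx, hn0, mul_zero])
  have i2 : IntegrableOn (fun x => Real.exp (b*x^2) * nsq (f x)) (Ioo xp 0) :=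
    agmon_integrable hK hφs
      (ContinuousOn.mul (by fun_prop) (agmon_nsq_cont.comp_continuousOn hfc))
      (fun x hx => by rw [hzf x hx, hn0, mul_zero])
  -- Hardy for a real linear functional of φ
  have hardy : ∀ L : (Fin 4 → ℂ) →L[ℝ] ℝ,
      IntegrableOn (fun x => Real.exp (b*x^2) * (L (φ x) * L (deriv (deriv φ) x)
        + L (φ x)^2 * (1/(4*x^2) - b^2*x^2))) (Ioo xp 0) ∧
      ∫ x in Ioo xp 0, Real.exp (b*x^2) * (L (φ x) * L (deriv (deriv φ) x)
        + L (φ x)^2 * (1/(4*x^2) - b^2*x^2)) ≤ 0 := by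
    intro L
    have := agmon_hardy (a := xp) (b := b) (fun x => L (φ x)) (L.contDiff.comp hφ) hK hφs
      (fun x hx => by simp [hz0 x hx])
    rw [agmon_comp_deriv L φ hφ] at this
    exact this
  let Lre : Fin 4 → (Fin 4 → ℂ) →L[ℝ] ℝ := fun j =>
    Complex.reCLM.comp (ContinuousLinearMap.proj (R := ℝ) (φ := fun _ : Fin 4 => ℂ) j)
  let Lim : Fin 4 → (Fin 4 → ℂ) →L[ℝ] ℝ := fun j =>
    Complex.imCLM.comp (ContinuousLinearMap.proj (R := ℝ) (φ := fun _ : Fin 4 => ℂ) j)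
  set S : ℝ → ℝ := fun x => ∑ j, (
      Real.exp (b*x^2) * (Lre j (φ x) * Lre j (deriv (deriv φ) x)
        + Lre j (φ x)^2 * (1/(4*x^2) - b^2*x^2)) +
      Real.exp (b*x^2) * (Lim j (φ x) * Lim j (deriv (deriv φ) x)
        + Lim j (φ x)^2 * (1/(4*x^2) - b^2*x^2))) with hS
  have iS : IntegrableOn S (Ioo xp 0) :=
    integrable_finsetSum _ fun j _ => (hardy (Lre j)).1.add (hardy (Lim j)).1
  have hS0 : ∫ x in Ioo xp 0, S x ≤ 0 := by
    simp only [hS]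
    rw [integral_finsetSum _ fun j _ => (hardy (Lre j)).1.fun_add (hardy (Lim j)).1]
    refine Finset.sum_nonpos fun j _ => ?_
    rw [integral_add (hardy (Lre j)).1 (hardy (Lim j)).1]
    linarith [(hardy (Lre j)).2, (hardy (Lim j)).2]
  have hSeq : ∀ x, S x = Real.exp (b*x^2) *
      (agmonIp (φ x) (deriv (deriv φ) x) + nsq (φ x) * (1/(4*x^2) - b^2*x^2)) := by
    intro x
    simp only [hS, agmonIp, nsq, Finset.sum_mul, ← Finset.sum_add_distrib, Finset.mul_sum]
    refine Finset.sum_congr rfl fun j _ => ?_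
    simp only [Lre, Lim, ContinuousLinearMap.comp_apply, ContinuousLinearMap.proj_apply,
      Complex.reCLM_apply, Complex.imCLM_apply, Complex.normSq_apply]
    ring
  have hpt : ∀ x ∈ Ioo xp 0, h/2 * (Real.exp (b*x^2) * nsq (φ x)) ≤
      h*D * nsq (φ x) + 1/(2*h) * (Real.exp (b*x^2) * nsq (f x)) + h^2 * S x := by
    intro x hx
    obtain ⟨p1, p2, p3⟩ := agmon_pot M l hM hl rSAdS hrS hFpos rfun hrange hinv1 hinv2 m hm xp hxp
      hA' hcond x hx
    have q := agmon_quad M l rfun m h x hh hm (φ x)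
    have hip := agmon_ip_le h hh (φ x) (f x)
    have hipf : agmonIp (φ x) (f x) = -h^2 * agmonIp (φ x) (deriv (deriv φ) x)
        + agmonIp (φ x) (Vpot M l rfun m h x *ᵥ φ x) - E * nsq (φ x) := by
      simp only [hf, agmonIp, nsq, Finset.mul_sum, ← Finset.sum_add_distrib,
        ← Finset.sum_sub_distrib]
      refine Finset.sum_congr rfl fun j _ => ?_
      have : (-(h:ℂ)^2) = ((-h^2 : ℝ) : ℂ) := by push_cast; ring
      simp only [this, Pi.add_apply, Pi.sub_apply, Pi.smul_apply, smul_eq_mul, Complex.add_re,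
        Complex.sub_re, Complex.add_im, Complex.sub_im, Complex.re_ofReal_mul,
        Complex.im_ofReal_mul, Complex.normSq_apply]
      ring
    change _ ≤ agmonIp (φ x) (Vpot M l rfun m h x *ᵥ φ x) at q
    have sc := agmon_scalar l C1 h x hl hC10 hh
    rw [← hb, ← hD] at sc
    have hN := agmon_nsq_nonneg (φ x)
    rw [hSeq]
    have hx20 : 0 < x^2 := by have := hx.2.ne; positivity
    have hbx : h^2 * (b^2*x^2) = 4*x^2/(25*l^4) := by rw [hb]; field_simp; ring
    -- scalar lower bound
    have hsc : x^2/(6*l^4) - C1*h ≤ (A M l rfun x)^2 + h^2 * m^2 * (B M l rfun x)^2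
        - h * |deriv (A M l rfun) x| - h^2 * m * |deriv (B M l rfun) x| - E
        + h^2 * (1/(4*x^2) - b^2*x^2) := by
      have t1 := mul_le_mul_of_nonneg_left p2 hh.le
      have t2 := mul_le_mul_of_nonneg_left p3 (sq_nonneg h)
      have t3 : h^2 * (1/(4*l^2)) ≤ h * (1/(4*l^2)) := by
        have : 0 < 1/(4*l^2) := by positivity
        have : h^2 ≤ h := by nlinarith
        gcongr
      have t4 : x^2/(6*l^4) + 4*x^2/(25*l^4) ≤ x^2/(3*l^4) := by
        have e : x^2/(3*l^4) - (x^2/(6*l^4) + 4*x^2/(25*l^4)) = x^2/l^4/150 := by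
          field_simp; ring
        have : 0 ≤ x^2/l^4/150 := by positivity
        linarith
      have t5 : C1*h = h*(1/(4*l^2)) + h*KA + T*h := by rw [hC1]; ring
      rw [mul_sub, hbx, t5]
      linarith
    have g1 := mul_le_mul_of_nonneg_right hsc hN
    have g2 : nsq (φ x) * (x^2/(6*l^4) - C1*h) - h/2 * nsq (φ x) - 1/(2*h) * nsq (f x) ≤
        h^2 * (agmonIp (φ x) (deriv (deriv φ) x) + nsq (φ x) * (1/(4*x^2) - b^2*x^2)) := by
      linarith
    have g3 := mul_le_mul_of_nonneg_left g2 (Real.exp_pos (b*x^2)).le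
    have g4 := mul_le_mul_of_nonneg_right sc hN
    linarith
  have hintegr := setIntegral_mono_on (i1.const_mul (h/2))
    (((i0.const_mul (h*D)).add (i2.const_mul (1/(2*h)))).add (iS.const_mul (h^2)))
    measurableSet_Ioo hpt
  have hint2 : h/2 * (∫ x in Ioo xp 0, Real.exp (b*x^2) * nsq (φ x)) ≤
      h*D * (∫ x in Ioo xp 0, nsq (φ x))
      + 1/(2*h) * (∫ x in Ioo xp 0, Real.exp (b*x^2) * nsq (f x)) := by
    have e : ∫ x in Ioo xp 0, (h*D * nsq (φ x) + 1/(2*h) * (Real.exp (b*x^2) * nsq (f x))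
          + h^2 * S x) = h*D * (∫ x in Ioo xp 0, nsq (φ x))
      + 1/(2*h) * (∫ x in Ioo xp 0, Real.exp (b*x^2) * nsq (f x))
      + h^2 * ∫ x in Ioo xp 0, S x := by
      rw [integral_add ((i0.const_mul (h*D)).fun_add (i2.const_mul (1/(2*h)))) (iS.const_mul (h^2)),
        integral_add (i0.const_mul (h*D)) (i2.const_mul (1/(2*h))),
        integral_const_mul, integral_const_mul, integral_const_mul]
    have e1 : ∫ x in Ioo xp 0, h/2 * (Real.exp (b*x^2) * nsq (φ x)) =
      h/2 * (∫ x in Ioo xp 0, Real.exp (b*x^2) * nsq (φ x)) := integral_const_mul _ _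
    have e2 : h^2 * ∫ x in Ioo xp 0, S x ≤ 0 := mul_nonpos_of_nonneg_of_nonpos (sq_nonneg h) hS0
    rw [← e1]
    refine hintegr.trans ?_
    simp only [Pi.add_apply]
    rw [e]
    linarith
  unfold L2norm
  simp only [agmon_nsq_smul, hw]
  refine agmon_final D h _ _ _ hD0 hh ?_ ?_ hint2
  · exact integral_nonneg fun x => agmon_nsq_nonneg _
  · exact integral_nonneg fun x => mul_nonneg (Real.exp_pos _).le (agmon_nsq_nonneg _)
end

section
/- Let m > 0 with ml > 1, let x₊ < 0 be such that A'(x) < 0 for all x ∈ [x₊, 0) and F(r)/(4l²) − F'(r)²/16 ≥ 0 for all r ≥ r(x₊), and let S > 0 satisfy 1/l² + S < A(x₊)². Then there exist h₀ > 0 and D > 0 such that for every h ∈ (0, h₀) there exist a real number E with 0 < E < 1/l² + S and a smooth function φ : (−∞, 0) → ℂ⁴ vanishing on (−∞, x₊], square-integrable with ∫_{−∞}^0 ‖φ(x)‖² dx = 1, such that the function Hφ defined by (Hφ)(x) = i γ⁰γ¹ h φ'(x) + A(x) γ⁰γ² φ(x) − h m B(x) γ⁰ φ(x) is square-integrable and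 ‖Hφ − √E · φ‖_{L²((−∞,0))} ≤ e^{−D/h}. -/
open MeasureTheory Set Matrix

/-- The Dirac matrix `γ⁰`. -/
noncomputable def γ0 : Matrix (Fin 4) (Fin 4) ℂ :=
  !![0, 0, Complex.I, 0;
     0, 0, 0, Complex.I;
     -Complex.I, 0, 0, 0;
     0, -Complex.I, 0, 0]

/-- The matrix `γ⁰γ¹ = diag(−1,1,1,−1)`. -/
noncomputable def γ01 : Matrix (Fin 4) (Fin 4) ℂ :=
  !![-1, 0, 0, 0;
     0, 1, 0, 0;
     0, 0, 1, 0;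
     0, 0, 0, -1]

/-- The matrix `γ⁰γ²`. -/
noncomputable def γ02 : Matrix (Fin 4) (Fin 4) ℂ :=
  !![0, -1, 0, 0;
     -1, 0, 0, 0;
     0, 0, 0, 1;
     0, 0, 1, 0]

/-- The Dirac operator `(Hφ)(x) = iγ⁰γ¹hφ'(x) + A(x)γ⁰γ²φ(x) − hmB(x)γ⁰φ(x)`. -/
noncomputable def Hop (M l : ℝ) (rfun : ℝ → ℝ) (m h : ℝ)
    (φ : ℝ → Fin 4 → ℂ) (x : ℝ) : Fin 4 → ℂ :=
  (Complex.I * ((h : ℝ) : ℂ)) • (γ01 *ᵥ deriv φ x)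
    + ((A M l rfun x : ℝ) : ℂ) • (γ02 *ᵥ φ x)
    - ((h * m * B M l rfun x : ℝ) : ℂ) • (γ0 *ᵥ φ x)


namespace Aux18

/-- The Prüfer vector field. -/
noncomputable def vf (P Q : ℝ → ℝ) (c : ℝ) (x t : ℝ) : ℝ :=
  c + P x * Real.cos (2*t) - Q x * Real.sin (2*t)

lemma abs_cos_sub (s t : ℝ) : |Real.cos (2*s) - Real.cos (2*t)| ≤ 2 * |s - t| := by
  have h := Real.lipschitzWith_cos.dist_le_mul (2*s) (2*t)
  rw [Real.dist_eq, Real.dist_eq, ← mul_sub, abs_mul] at h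
  simpa using h

lemma abs_sin_sub (s t : ℝ) : |Real.sin (2*s) - Real.sin (2*t)| ≤ 2 * |s - t| := by
  have h := Real.lipschitzWith_sin.dist_le_mul (2*s) (2*t)
  rw [Real.dist_eq, Real.dist_eq, ← mul_sub, abs_mul] at h
  simpa using h

lemma vf_lip {P Q : ℝ → ℝ} {c x : ℝ} {C : NNReal} (hP : |P x| ≤ C) (hQ : |Q x| ≤ C) :
    LipschitzWith (4*C) (vf P Q c x) := by
  refine LipschitzWith.of_dist_le_mul fun s t => ?_
  rw [Real.dist_eq, Real.dist_eq]
  have e : vf P Q c x s - vf P Q c x t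
      = P x * (Real.cos (2*s) - Real.cos (2*t)) - Q x * (Real.sin (2*s) - Real.sin (2*t)) := by
    unfold vf; ring
  rw [e]
  have h0 : (0:ℝ) ≤ C := C.2
  have h1 : |P x * (Real.cos (2*s) - Real.cos (2*t))| ≤ C * (2 * |s - t|) := by
    rw [abs_mul]; exact mul_le_mul hP (abs_cos_sub s t) (abs_nonneg _) h0
  have h2 : |Q x * (Real.sin (2*s) - Real.sin (2*t))| ≤ C * (2 * |s - t|) := by
    rw [abs_mul]; exact mul_le_mul hQ (abs_sin_sub s t) (abs_nonneg _) h0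
  have h3 := abs_sub (P x * (Real.cos (2*s) - Real.cos (2*t)))
    (Q x * (Real.sin (2*s) - Real.sin (2*t)))
  push_cast
  nlinarith

lemma exists_bound {P Q : ℝ → ℝ} (hP : ContinuousOn P (Iio 0)) (hQ : ContinuousOn Q (Iio 0))
    {y b : ℝ} (hb : b < 0) : ∃ C : NNReal, ∀ x ∈ Icc y b, |P x| ≤ C ∧ |Q x| ≤ C := by
  have hs : Icc y b ⊆ Iio 0 := fun x hx => lt_of_le_of_lt hx.2 hb
  obtain ⟨C1, h1⟩ := isCompact_Icc.exists_bound_of_continuousOn (hP.mono hs)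
  obtain ⟨C2, h2⟩ := isCompact_Icc.exists_bound_of_continuousOn (hQ.mono hs)
  refine ⟨Real.toNNReal (max C1 C2), fun x hx => ?_⟩
  have := Real.le_coe_toNNReal (max C1 C2)
  exact ⟨((h1 x hx).trans (le_max_left _ _)).trans this,
    ((h2 x hx).trans (le_max_right _ _)).trans this⟩

lemma ode_compact {P Q : ℝ → ℝ} (hP : ContinuousOn P (Iio 0)) (hQ : ContinuousOn Q (Iio 0))
    (c : ℝ) {a b : ℝ} (hab : a < b) (hb : b < 0) :
    ∃ θ : ℝ → ℝ, θ a = 0 ∧ ∀ x ∈ Ioo (a-1) b, HasDerivAt θ (vf P Q c x (θ x)) x := by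
  obtain ⟨C, hC⟩ := exists_bound hP hQ (y := a - 1) hb
  have hs : Icc (a-1) b ⊆ Iio 0 := fun x hx => lt_of_le_of_lt hx.2 hb
  let L : NNReal := Real.toNNReal |c| + 2 * C
  let T : NNReal := Real.toNNReal (max (b - a) (a - (a-1)))
  have hpl : IsPicardLindelof (vf P Q c) (tmin := a-1) (tmax := b) ⟨a, by constructor <;> linarith⟩
      (0:ℝ) (L * T) 0 L (4 * C) := by
    refine ⟨fun t ht => (vf_lip (hC t ht).1 (hC t ht).2).lipschitzOnWith, fun x _ => ?_,
      fun t ht x _ => ?_, ?_⟩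
    · have h1 := hP.mono hs
      have h2 := hQ.mono hs
      unfold vf
      fun_prop
    · have h1 := hC t ht
      have hcos := Real.abs_cos_le_one (2*x)
      have hsin := Real.abs_sin_le_one (2*x)
      have h2 : |P t * Real.cos (2*x)| ≤ C := by
        rw [abs_mul]; nlinarith [abs_nonneg (P t)]
      have h3 : |Q t * Real.sin (2*x)| ≤ C := by
        rw [abs_mul]; nlinarith [abs_nonneg (Q t)]
      rw [Real.norm_eq_abs]
      have h4 : (L:ℝ) = |c| + 2 * C := by simp [L]
      rw [h4]; unfold vf
      have := abs_sub (c + P t * Real.cos (2*x)) (Q t * Real.sin (2*x))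
      have := abs_add_le c (P t * Real.cos (2*x))
      linarith
    · have : (T:ℝ) = max (b - a) (a - (a-1)) := by
        simp only [T]; rw [Real.coe_toNNReal _ (le_max_of_le_left (by linarith))]
      push_cast
      rw [this]; simp
  obtain ⟨θ, h0, h1⟩ := hpl.exists_eq_forall_mem_Icc_hasDerivWithinAt₀
  exact ⟨θ, h0, fun x hx => (h1 x (Ioo_subset_Icc_self hx)).hasDerivAt (Icc_mem_nhds hx.1 hx.2)⟩

lemma ode_exists {P Q : ℝ → ℝ} (hP : ContinuousOn P (Iio 0)) (hQ : ContinuousOn Q (Iio 0))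
    (c : ℝ) {a : ℝ} (ha : a < 0) :
    ∃ θ : ℝ → ℝ, θ a = 0 ∧ ∀ x ∈ Ioo (a-1) 0, HasDerivAt θ (vf P Q c x (θ x)) x := by
  have key : ∀ b : ℝ, ∃ θ : ℝ → ℝ, a < b → b < 0 → θ a = 0 ∧
      ∀ x ∈ Ioo (a-1) b, HasDerivAt θ (vf P Q c x (θ x)) x := by
    intro b
    by_cases h : a < b ∧ b < 0
    · obtain ⟨θ, h1⟩ := ode_compact hP hQ c h.1 h.2
      exact ⟨θ, fun _ _ => h1⟩
    · exact ⟨fun _ => 0, fun h1 h2 => absurd ⟨h1, h2⟩ h⟩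
  choose Θ hΘ using key
  have uniq : ∀ b b', a < b → b ≤ b' → b' < 0 → EqOn (Θ b) (Θ b') (Ioo (a-1) b) := by
    intro b b' hab hbb hb'
    obtain ⟨C, hC⟩ := exists_bound hP hQ (y := a - 1) (lt_of_le_of_lt hbb hb')
    obtain ⟨h1, h2⟩ := hΘ b hab (by linarith)
    obtain ⟨h3, h4⟩ := hΘ b' (by linarith) hb'
    exact ODE_solution_unique_of_mem_Ioo (v := vf P Q c) (s := fun _ => univ) (K := 4 * C) (t₀ := a)
      (fun t ht => (vf_lip (hC t (Ioo_subset_Icc_self ht)).1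
        (hC t (Ioo_subset_Icc_self ht)).2).lipschitzOnWith) ⟨by linarith, hab⟩
      (fun t ht => ⟨h2 t ht, trivial⟩)
      (fun t ht => ⟨h4 t ⟨ht.1, lt_of_lt_of_le ht.2 hbb⟩, trivial⟩) (by rw [h1, h3])
  have hβ : ∀ x : ℝ, x < 0 → a < max x a / 2 ∧ max x a / 2 < 0 ∧ x < max x a / 2 := by
    intro x hx
    have h1 := le_max_left x a
    have h2 := le_max_right x a
    have h3 : max x a < 0 := max_lt hx ha
    refine ⟨?_, ?_, ?_⟩ <;> linarith
  refine ⟨fun x => Θ (max x a / 2) x, ?_, fun x hx => ?_⟩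
  · have := hβ a ha
    exact (hΘ _ this.1 this.2.1).1
  · obtain ⟨h1, h2, h3⟩ := hβ x hx.2
    have hd := (hΘ _ h1 h2).2 x ⟨hx.1, h3⟩
    refine hd.congr_of_eventuallyEq ?_
    filter_upwards [Ioo_mem_nhds hx.1 h3] with y hy
    obtain ⟨g1, g2, g3⟩ := hβ y (hy.2.trans h2)
    rcases le_total (max y a / 2) (max x a / 2) with h | h
    · exact uniq _ _ g1 h h2 ⟨hy.1, g3⟩
    · exact (uniq _ _ h1 h g2 hy).symm


lemma barrier {θ θ' : ℝ → ℝ} {c x1 x2 : ℝ} (h12 : x1 ≤ x2)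
    (hd : ∀ x ∈ Icc x1 x2, HasDerivAt θ (θ' x) x) (h1 : θ x1 ≤ c)
    (hb : ∀ x ∈ Ico x1 x2, θ x = c → θ' x < 0) : θ x2 ≤ c := by
  refine image_le_of_deriv_right_lt_deriv_boundary (f := θ) (f' := θ') (B := fun _ => c)
    (B' := fun _ => 0) (HasDerivAt.continuousOn hd)
    (fun x hx => (hd x (Ico_subset_Icc_self hx)).hasDerivWithinAt) h1
    (fun x => hasDerivAt_const x c) hb ⟨h12, le_rfl⟩

lemma barrier' {θ θ' : ℝ → ℝ} {c x1 x2 : ℝ} (h12 : x1 ≤ x2)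
    (hd : ∀ x ∈ Icc x1 x2, HasDerivAt θ (θ' x) x) (h1 : c ≤ θ x1)
    (hb : ∀ x ∈ Ico x1 x2, θ x = c → 0 < θ' x) : c ≤ θ x2 := by
  have := barrier (θ := fun x => - θ x) (θ' := fun x => - θ' x) (c := -c) h12
    (fun x hx => (hd x hx).neg) (by simpa using h1)
    (fun x hx h => by have := hb x hx (by linarith); linarith)
  linarith

/-- `θ` solves the Prüfer equation with zero initial value at `a`. -/
def Sol (P Q : ℝ → ℝ) (a c : ℝ) (θ : ℝ → ℝ) : Prop :=
  θ a = 0 ∧ ∀ x ∈ Ioo (a-1) 0, HasDerivAt θ (vf P Q c x (θ x)) x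

lemma sol_cont {P Q : ℝ → ℝ} (hP : ContinuousOn P (Iio 0)) (hQ : ContinuousOn Q (Iio 0))
    {a : ℝ} {Θ : ℝ → ℝ → ℝ} (hΘ : ∀ c, Sol P Q a c (Θ c)) {x : ℝ} (hax : a ≤ x) (hx : x < 0) :
    Continuous (fun c => Θ c x) := by
  obtain ⟨C, hC⟩ := exists_bound hP hQ (y := a) hx
  have hsub : ∀ t ∈ Icc a x, t ∈ Ioo (a-1) 0 := fun t ht =>
    ⟨by linarith [ht.1], lt_of_le_of_lt ht.2 hx⟩
  have hest : ∀ c c', dist (Θ c' x) (Θ c x)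
      ≤ gronwallBound 0 ((4 * C : NNReal) : ℝ) (|c' - c| + 0) (x - a) := by
    intro c c'
    refine dist_le_of_approx_trajectories_ODE_of_mem (v := vf P Q c) (s := fun _ => univ)
      (K := 4 * C) (a := a) (b := x)
      (f' := fun t => vf P Q c' t (Θ c' t)) (g' := fun t => vf P Q c t (Θ c t))
      (fun t ht => (vf_lip (hC t (Ico_subset_Icc_self ht)).1
        (hC t (Ico_subset_Icc_self ht)).2).lipschitzOnWith)
      (HasDerivAt.continuousOn fun t ht => (hΘ c').2 t (hsub t ht))
      (fun t ht => ((hΘ c').2 t (hsub t (Ico_subset_Icc_self ht))).hasDerivWithinAt)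
      (fun t ht => ?_) (fun _ _ => trivial)
      (HasDerivAt.continuousOn fun t ht => (hΘ c).2 t (hsub t ht))
      (fun t ht => ((hΘ c).2 t (hsub t (Ico_subset_Icc_self ht))).hasDerivWithinAt)
      (fun t ht => by simp) (fun _ _ => trivial) (by rw [(hΘ c).1, (hΘ c').1]; simp) x ⟨hax, le_rfl⟩
    rw [Real.dist_eq]
    apply le_of_eq
    congr 1
    unfold vf; ring
  rw [continuous_iff_continuousAt]
  intro c
  rw [ContinuousAt, tendsto_iff_dist_tendsto_zero]
  have hlim : Filter.Tendsto (fun c' => gronwallBound 0 ((4 * C : NNReal) : ℝ) (|c' - c| + 0) (x - a))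
      (nhds c) (nhds 0) := by
    have hcont : Continuous (fun c' =>
        gronwallBound 0 ((4 * C : NNReal) : ℝ) (|c' - c| + 0) (x - a)) :=
      (gronwallBound_continuous_ε 0 _ (x - a)).comp (by fun_prop)
    have := hcont.tendsto c
    simpa [gronwallBound_ε0_δ0] using this
  exact squeeze_zero (fun _ => dist_nonneg) (fun c' => hest c c') hlim

lemma vf_pi_half {P Q : ℝ → ℝ} {c x t : ℝ} (ht : t = Real.pi/2) : vf P Q c x t = c - P x := by
  subst ht; unfold vf
  rw [show 2 * (Real.pi/2) = Real.pi by ring]; simp; ring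

lemma vf_pi_four {P Q : ℝ → ℝ} {c x t : ℝ} (ht : t = Real.pi/4) : vf P Q c x t = c - Q x := by
  subst ht; unfold vf
  rw [show 2 * (Real.pi/4) = Real.pi/2 by ring]; simp

lemma vf_zero {P Q : ℝ → ℝ} {c x t : ℝ} (ht : t = 0) : vf P Q c x t = c + P x := by
  subst ht; unfold vf; simp

/-- The shooting argument. -/
lemma shooting {P Q : ℝ → ℝ} (hP : ContinuousOn P (Iio 0)) (hQ : ContinuousOn Q (Iio 0))
    {a c0 c1 : ℝ} (ha : a < 0) (hc0 : 0 < c0) (hc01 : c0 ≤ c1)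
    (hPanti : ∀ x y, a ≤ x → x < y → y < 0 → P y < P x)
    (hP0 : ∀ x, a ≤ x → x < 0 → c0 < P x)
    (hQ0 : ∃ x0, a ≤ x0 ∧ x0 < 0 ∧ ∀ x, x0 ≤ x → x < 0 → c1 < Q x)
    {y1 y2 η : ℝ} (hy1 : a ≤ y1) (hy12 : y1 ≤ y2) (hy2 : y2 < 0)
    (hosc : ∀ x ∈ Icc y1 y2, P x + |Q x| + η ≤ c1) (hη : Real.pi/2 < η * (y2 - y1)) :
    ∃ c θ, c0 ≤ c ∧ c ≤ c1 ∧ Sol P Q a c θ ∧ (∀ x, a ≤ x → x < 0 → 0 ≤ θ x ∧ θ x ≤ Real.pi/2) ∧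
      ∃ x0, a ≤ x0 ∧ x0 < 0 ∧ ∀ x, x0 ≤ x → x < 0 → Real.pi/4 ≤ θ x := by
  have hpi := Real.pi_pos
  have hex : ∀ c, ∃ θ, Sol P Q a c θ := fun c => ode_exists hP hQ c ha
  choose Θ hΘ using hex
  have hder : ∀ c x1 x2, a ≤ x1 → x2 < 0 → ∀ x ∈ Icc x1 x2,
      HasDerivAt (Θ c) (vf P Q c x (Θ c x)) x := fun c x1 x2 h1 h2 x hx =>
    (hΘ c).2 x ⟨by linarith [hx.1], by linarith [hx.2]⟩
  have hnn : ∀ c, c0 ≤ c → ∀ x, a ≤ x → x < 0 → 0 ≤ Θ c x := by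
    intro c hc x hax hx
    refine barrier' hax (hder c a x le_rfl hx) (le_of_eq (hΘ c).1.symm) fun y hy hy0 => ?_
    rw [vf_zero hy0]
    linarith [hP0 y hy.1 (hy.2.trans hx)]
  -- in the forbidden region the angle stays below `π/2`
  have hforb : ∀ c x, a ≤ x → x < 0 → c ≤ P x → Θ c x ≤ Real.pi/2 := by
    intro c x hax hx hcx
    refine barrier hax (hder c a x le_rfl hx) (by rw [(hΘ c).1]; linarith) fun y hy hy0 => ?_
    rw [vf_pi_half hy0]
    linarith [hPanti y x hy.1 hy.2 hx]
  obtain ⟨x0, hax0, hx0, hQx0⟩ := hQ0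
  let U : Set ℝ := {c | ∃ x, x0 ≤ x ∧ x < 0 ∧ Θ c x < Real.pi/4}
  let W : Set ℝ := {c | ∃ x, a ≤ x ∧ x < 0 ∧ Real.pi/2 < Θ c x}
  have hUo : IsOpen U := by
    have : U = ⋃ x ∈ Ico x0 0, {c | Θ c x < Real.pi/4} := by
      ext c; simp [U, and_assoc]
    rw [this]
    exact isOpen_biUnion fun x hx =>
      isOpen_lt (sol_cont hP hQ hΘ (hax0.trans hx.1) hx.2) continuous_const
  have hWo : IsOpen W := by
    have : W = ⋃ x ∈ Ico a 0, {c | Real.pi/2 < Θ c x} := by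
      ext c; simp [W, and_assoc]
    rw [this]
    exact isOpen_biUnion fun x hx =>
      isOpen_lt continuous_const (sol_cont hP hQ hΘ hx.1 hx.2)
  have hdisj : ∀ c, c0 ≤ c → c ≤ c1 → c ∈ U → c ∈ W → False := by
    rintro c hc0 hc1 ⟨x, hx1, hx2, hx3⟩ ⟨y, hy1, hy2, hy3⟩
    rcases le_total x y with hxy | hxy
    · have : Θ c y ≤ Real.pi/4 := by
        refine barrier hxy (hder c x y (hax0.trans hx1) hy2) hx3.le fun z hz hz0 => ?_
        rw [vf_pi_four hz0]
        linarith [hQx0 z (hx1.trans hz.1) (hz.2.trans hy2)]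
      linarith
    · have hPy : P y < c := by
        by_contra hcon
        linarith [hforb c y hy1 hy2 (not_lt.mp hcon)]
      have : Real.pi/2 ≤ Θ c x := by
        refine barrier' hxy (hder c y x hy1 hx2) hy3.le fun z hz hz0 => ?_
        rw [vf_pi_half hz0]
        rcases hz.1.eq_or_lt with h | h
        · rw [← h]; linarith
        · linarith [hPanti y z hy1 h (hz.2.trans hx2)]
      linarith
  have h0W : c0 ∉ W := by
    rintro ⟨y, hy1, hy2, hy3⟩
    linarith [hforb c0 y hy1 hy2 (hP0 y hy1 hy2).le]
  have h1W : c1 ∈ W := by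
    refine ⟨y2, hy1.trans hy12, hy2, ?_⟩
    have hmono : η * (y2 - y1) ≤ Θ c1 y2 - Θ c1 y1 := by
      refine Convex.mul_sub_le_image_sub_of_le_deriv (convex_Icc y1 y2)
        (HasDerivAt.continuousOn (hder c1 y1 y2 hy1 hy2))
        (fun x hx => (hder c1 y1 y2 hy1 hy2 x (interior_subset hx)).differentiableAt.differentiableWithinAt)
        (fun x hx => ?_) y1 ⟨le_rfl, hy12⟩ y2 ⟨hy12, le_rfl⟩ hy12
      have hx' := interior_subset hx
      rw [(hder c1 y1 y2 hy1 hy2 x hx').deriv]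
      have h1 := hosc x hx'
      have h2 := hP0 x (hy1.trans hx'.1) (lt_of_le_of_lt hx'.2 hy2)
      have h3 := Real.neg_one_le_cos (2 * Θ c1 x)
      have h4 : Q x * Real.sin (2 * Θ c1 x) ≤ |Q x| := by
        refine (le_abs_self _).trans ?_
        rw [abs_mul]
        exact mul_le_of_le_one_right (abs_nonneg _) (Real.abs_sin_le_one _)
      unfold vf
      nlinarith
    linarith [hnn c1 hc01 y1 hy1 (by linarith)]
  by_contra hcon
  have hcov : Icc c0 c1 ⊆ U ∪ W := by
    intro c hc
    by_contra hUW
    rw [mem_union, not_or] at hUW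
    refine hcon ⟨c, Θ c, hc.1, hc.2, hΘ c, fun x hx1 hx2 => ⟨hnn c hc.1 x hx1 hx2, ?_⟩,
      x0, hax0, hx0, fun x hx1 hx2 => ?_⟩
    · by_contra h; exact hUW.2 ⟨x, hx1, hx2, not_le.mp h⟩
    · by_contra h; exact hUW.1 ⟨x, hx1, hx2, not_le.mp h⟩
  have hc0m : c0 ∈ Icc c0 c1 := ⟨le_rfl, hc01⟩
  have hc1m : c1 ∈ Icc c0 c1 := ⟨hc01, le_rfl⟩
  obtain ⟨c, hc, hcU, hcW⟩ := isPreconnected_Icc U W hUo hWo hcov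
    ⟨c0, hc0m, (hcov hc0m).resolve_right h0W⟩ ⟨c1, hc1m, h1W⟩
  exact hdisj c hc.1 hc.2 hcU hcW

lemma smooth_of_ode {y G : ℝ → ℝ} {s : Set ℝ} (hs : IsOpen s) (hd : ∀ x ∈ s, HasDerivAt y (G x) x)
    (hG : ∀ n : ℕ, ContDiffOn ℝ n y s → ContDiffOn ℝ n G s) :
    ContDiffOn ℝ (⊤ : ℕ∞) y s := by
  rw [contDiffOn_infty]
  intro n
  induction n with
  | zero =>
    simp only [Nat.cast_zero, contDiffOn_zero]
    exact HasDerivAt.continuousOn hd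
  | succ n ih =>
    push_cast
    rw [contDiffOn_succ_iff_deriv_of_isOpen hs]
    refine ⟨fun x hx => (hd x hx).differentiableAt.differentiableWithinAt, by simp, ?_⟩
    exact (hG n ih).congr fun x hx => (hd x hx).deriv

lemma core {P Q : ℝ → ℝ} (hP : ContDiffOn ℝ (⊤ : ℕ∞) P (Iio 0))
    (hQ : ContDiffOn ℝ (⊤ : ℕ∞) Q (Iio 0)) (hQnn : ∀ x, x < 0 → 0 ≤ Q x)
    {a c : ℝ} (ha : a < 0) {θ : ℝ → ℝ} (hθ : Sol P Q a c θ)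
    {KP : ℝ} (hPb : ∀ x, a ≤ x → x < 0 → 0 ≤ P x ∧ P x ≤ KP)
    (hθb : ∀ x, a ≤ x → x < 0 → 0 ≤ θ x ∧ θ x ≤ Real.pi/2)
    (hθ0 : ∃ x0, a ≤ x0 ∧ x0 < 0 ∧ ∀ x, x0 ≤ x → x < 0 → Real.pi/4 ≤ θ x)
    {b1 L κ : ℝ} (hb1 : a ≤ b1) (hL : 0 < L) (hb3 : b1 + 2 * L < 0) (hκ : 0 < κ)
    (hc : 0 ≤ c) (hPκ : ∀ x, a ≤ x → x ≤ b1 + 2 * L → c + κ ≤ P x) :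
    ∃ R : ℝ → ℝ, ContDiffOn ℝ (⊤ : ℕ∞) θ (Ioo (a-1) 0) ∧ ContDiffOn ℝ (⊤ : ℕ∞) R (Ioo (a-1) 0) ∧
      (∀ x ∈ Ioo (a-1) 0, HasDerivAt R
        (Q x * Real.cos (2 * θ x) + P x * Real.sin (2 * θ x)) x) ∧
      (∃ K, ∀ x, a ≤ x → x < 0 → Real.exp (2 * R x) ≤ K) ∧
      (2 * κ * L) * (∫ x in a..b1, Real.exp (2 * R x)) ≤ Real.exp (-(2 * κ * L)) *
        ∫ x in (b1+L)..(b1 + 2 * L), Real.exp (2 * R x) := by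
  have hsub : Ioo (a-1) 0 ⊆ Iio 0 := fun x hx => hx.2
  have hPs := hP.mono hsub
  have hQs := hQ.mono hsub
  have hθs : ContDiffOn ℝ (⊤ : ℕ∞) θ (Ioo (a-1) 0) := by
    refine smooth_of_ode isOpen_Ioo hθ.2 fun n hn => ?_
    have h1 : ContDiffOn ℝ n P (Ioo (a-1) 0) := hPs.of_le (by exact_mod_cast le_top)
    have h2 : ContDiffOn ℝ n Q (Ioo (a-1) 0) := hQs.of_le (by exact_mod_cast le_top)
    unfold vf
    exact (contDiffOn_const.add (h1.mul (Real.contDiff_cos.comp_contDiffOn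
      (contDiffOn_const.mul hn)))).sub (h2.mul (Real.contDiff_sin.comp_contDiffOn
      (contDiffOn_const.mul hn)))
  set G : ℝ → ℝ := fun x => Q x * Real.cos (2 * θ x) + P x * Real.sin (2 * θ x) with hG
  have hGs : ContDiffOn ℝ (⊤ : ℕ∞) G (Ioo (a-1) 0) :=
    (hQs.mul (Real.contDiff_cos.comp_contDiffOn (contDiffOn_const.mul hθs))).add
      (hPs.mul (Real.contDiff_sin.comp_contDiffOn (contDiffOn_const.mul hθs)))
  set R : ℝ → ℝ := fun x => ∫ t in a..x, G t with hR
  have hRd : ∀ x ∈ Ioo (a-1) 0, HasDerivAt R (G x) x := by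
    intro x hx
    have haI : a ∈ Ioo (a-1) 0 := ⟨by linarith, ha⟩
    refine intervalIntegral.integral_hasDerivAt_right ?_ ?_ ?_
    · refine (hGs.continuousOn.mono ?_).intervalIntegrable
      exact (ordConnected_Ioo).uIcc_subset haI hx
    · exact hGs.continuousOn.stronglyMeasurableAtFilter isOpen_Ioo x hx
    · exact hGs.continuousOn.continuousAt (isOpen_Ioo.mem_nhds hx)
  have hRs : ContDiffOn ℝ (⊤ : ℕ∞) R (Ioo (a-1) 0) := by
    refine smooth_of_ode isOpen_Ioo hRd fun n _ => ?_
    exact hGs.of_le (by exact_mod_cast le_top)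
  have hEc : ContinuousOn (fun x => Real.exp (2 * R x)) (Ioo (a-1) 0) := by
    have := hRs.continuousOn
    fun_prop
  refine ⟨R, hθs, hRs, hRd, ?_, ?_⟩
  · obtain ⟨x0, hax0, hx0, h0⟩ := hθ0
    have hs0 : Icc a x0 ⊆ Ioo (a-1) 0 := fun x hx => ⟨by linarith [hx.1], by linarith [hx.2]⟩
    obtain ⟨K, hK⟩ := isCompact_Icc.exists_bound_of_continuousOn (hEc.mono hs0)
    refine ⟨max K (Real.exp (2 * (R x0 + KP * (0 - x0)))), fun x hax hx => ?_⟩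
    rcases le_total x x0 with h | h
    · exact le_max_of_le_left ((le_abs_self _).trans (hK x ⟨hax, h⟩))
    · refine le_max_of_le_right (Real.exp_le_exp.mpr ?_)
      have hKP : 0 ≤ KP := (hPb a le_rfl ha).1.trans (hPb a le_rfl ha).2
      have hs1 : ∀ y ∈ Icc x0 x, y ∈ Ioo (a-1) 0 := fun y hy =>
        ⟨by linarith [hy.1], by linarith [hy.2]⟩
      have hm : R x - R x0 ≤ KP * (x - x0) := by
        refine Convex.image_sub_le_mul_sub_of_deriv_le (convex_Icc x0 x)
          (HasDerivAt.continuousOn fun y hy => hRd y (hs1 y hy))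
          (fun y hy => (hRd y (hs1 y (interior_subset hy))).differentiableAt.differentiableWithinAt)
          (fun y hy => ?_) x0 ⟨le_rfl, h⟩ x ⟨h, le_rfl⟩ h
        have hy' := interior_subset hy
        have hyI := hs1 y hy'
        rw [(hRd y hyI).deriv]
        have hay : a ≤ y := hax0.trans hy'.1
        have g1 := h0 y hy'.1 hyI.2
        have g2 := (hθb y hay hyI.2).2
        have g3 : Real.cos (2 * θ y) ≤ 0 :=
          Real.cos_nonpos_of_pi_div_two_le_of_le (by linarith) (by linarith)
        have g4 := Real.sin_le_one (2 * θ y)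
        have g5 := hPb y hay hyI.2
        have g6 := hQnn y hyI.2
        simp only [hG]
        nlinarith
      nlinarith
  · -- the Agmon type estimate
    set p : ℝ → ℝ := fun x => Real.exp (2 * R x) * Real.sin (2 * θ x) / 2 with hp
    set b3 := b1 + 2 * L with hb3'
    have hs3 : ∀ y ∈ Icc a b3, y ∈ Ioo (a-1) 0 := fun y hy =>
        ⟨by linarith [hy.1], by linarith [hy.2]⟩
    have hpd : ∀ y ∈ Icc a b3, ∃ d, HasDerivAt p d y ∧ κ * Real.exp (2 * R y) ≤ d := by
      intro y hy
      have hyI := hs3 y hy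
      have e1 := ((hRd y hyI).const_mul 2).exp
      have e2 := ((hθ.2 y hyI).const_mul 2).sin
      refine ⟨_, (e1.mul e2).div_const 2, ?_⟩
      have hE := Real.exp_pos (2 * R y)
      have hPy := hPκ y hy.1 hy.2
      have e3 : (Real.exp (2 * R y) * (2 * G y) * Real.sin (2 * θ y) +
          Real.exp (2 * R y) * (Real.cos (2 * θ y) * (2 * vf P Q c y (θ y)))) / 2
          = Real.exp (2 * R y) * (P y + c * Real.cos (2 * θ y)) := by
        have hsc := Real.sin_sq_add_cos_sq (2 * θ y)
        simp only [hG, vf]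
        linear_combination Real.exp (2 * R y) * P y * hsc
      refine le_trans ?_ (le_of_eq e3.symm)
      have := Real.neg_one_le_cos (2 * θ y)
      nlinarith [mul_nonneg hc (by linarith : 0 ≤ Real.cos (2 * θ y) + 1)]
    have hpnn : ∀ y ∈ Icc a b3, 0 ≤ p y := by
      intro y hy
      have h1 := hθb y hy.1 (hs3 y hy).2
      have := Real.sin_nonneg_of_nonneg_of_le_pi (x := 2 * θ y) (by linarith) (by linarith)
      simp only [hp]; positivity
    have hple : ∀ y, 2 * p y ≤ Real.exp (2 * R y) := by
      intro y
      have := Real.sin_le_one (2 * θ y)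
      simp only [hp]
      nlinarith [Real.exp_pos (2 * R y)]
    choose! d hd hdge using hpd
    have hpc : ContinuousOn p (Icc a b3) := HasDerivAt.continuousOn hd
    have hEI : ∀ u v, a ≤ u → u ≤ v → v ≤ b3 →
        IntervalIntegrable (fun x => Real.exp (2 * R x)) volume u v := by
      intro u v h1 h2 h3
      refine (hEc.mono fun y hy => ?_).intervalIntegrable
      rw [uIcc_of_le h2] at hy
      exact hs3 y ⟨h1.trans hy.1, hy.2.trans h3⟩
    -- (i)
    have hi : κ * (∫ x in a..b1, Real.exp (2 * R x)) ≤ p b1 := by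
      have hs : Icc a b1 ⊆ Icc a b3 := Icc_subset_Icc le_rfl (by linarith)
      have hmono : MonotoneOn (fun x => p x - κ * ∫ t in a..x, Real.exp (2 * R t)) (Icc a b1) := by
        have hder : ∀ y ∈ Icc a b1, HasDerivAt
            (fun x => p x - κ * ∫ t in a..x, Real.exp (2 * R t))
            (d y - κ * Real.exp (2 * R y)) y := by
          intro y hy
          refine (hd y (hs hy)).sub (HasDerivAt.const_mul κ ?_)
          refine intervalIntegral.integral_hasDerivAt_right
            (hEI a y le_rfl hy.1 (hs hy).2) ?_ ?_
          · exact hEc.stronglyMeasurableAtFilter isOpen_Ioo y (hs3 y (hs hy))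
          · exact hEc.continuousAt (isOpen_Ioo.mem_nhds (hs3 y (hs hy)))
        refine monotoneOn_of_deriv_nonneg (convex_Icc a b1) (HasDerivAt.continuousOn hder)
          (fun y hy => (hder y (interior_subset hy)).differentiableAt.differentiableWithinAt)
          (fun y hy => ?_)
        rw [(hder y (interior_subset hy)).deriv]
        linarith [hdge y (hs (interior_subset hy))]
      have := hmono ⟨le_rfl, hb1⟩ ⟨hb1, le_rfl⟩ hb1
      simp only [intervalIntegral.integral_same] at this
      linarith [hpnn a ⟨le_rfl, by linarith⟩]
    -- (ii)
    have hii : p b1 ≤ Real.exp (-(2 * κ * L)) * p (b1 + L) := by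
      have hs : Icc b1 (b1+L) ⊆ Icc a b3 := Icc_subset_Icc hb1 (by linarith)
      have hder : ∀ y ∈ Icc b1 (b1+L), HasDerivAt (fun x => Real.exp (-(2 * κ * (x - b1))) * p x)
          (Real.exp (-(2 * κ * (y - b1))) * (d y - 2 * κ * p y)) y := by
        intro y hy
        have e1 : HasDerivAt (fun x : ℝ => -(2 * κ * (x - b1))) (-(2 * κ * 1)) y :=
          (((hasDerivAt_id y).sub_const b1).const_mul (2 * κ)).neg
        exact (e1.exp.mul (hd y (hs hy))).congr_deriv (by ring)
      have hmono : MonotoneOn (fun x => Real.exp (-(2 * κ * (x - b1))) * p x)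
          (Icc b1 (b1+L)) := by
        refine monotoneOn_of_deriv_nonneg (convex_Icc _ _) (HasDerivAt.continuousOn hder)
          (fun y hy => (hder y (interior_subset hy)).differentiableAt.differentiableWithinAt)
          (fun y hy => ?_)
        rw [(hder y (interior_subset hy)).deriv]
        have h1 := hdge y (hs (interior_subset hy))
        have h2 := hple y
        refine mul_nonneg (Real.exp_pos _).le ?_
        nlinarith
      have := hmono ⟨le_rfl, by linarith⟩ ⟨by linarith, le_rfl⟩ (by linarith : b1 ≤ b1 + L)
      simpa using this
    -- (iii)
    have hiii : 2 * L * p (b1 + L) ≤ ∫ x in (b1+L)..b3, Real.exp (2 * R x) := by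
      have hs : Icc (b1+L) b3 ⊆ Icc a b3 := Icc_subset_Icc (by linarith) le_rfl
      have hmono : MonotoneOn p (Icc (b1+L) b3) := by
        refine monotoneOn_of_deriv_nonneg (convex_Icc _ _) (hpc.mono hs)
          (fun y hy => (hd y (hs (interior_subset hy))).differentiableAt.differentiableWithinAt)
          (fun y hy => ?_)
        rw [(hd y (hs (interior_subset hy))).deriv]
        have h1 := hdge y (hs (interior_subset hy))
        have := mul_pos hκ (Real.exp_pos (2 * R y))
        linarith
      have h1 : ∫ x in (b1+L)..b3, (2 * p (b1+L)) ≤ ∫ x in (b1+L)..b3, Real.exp (2 * R x) := by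
        refine intervalIntegral.integral_mono_on (by linarith) (by simp)
          (hEI _ _ (by linarith) (by linarith) le_rfl) fun x hx => ?_
        have := hmono ⟨le_rfl, by linarith⟩ hx hx.1
        linarith [hple x]
      rw [intervalIntegral.integral_const, smul_eq_mul] at h1
      have : b3 - (b1 + L) = L := by simp only [hb3']; ring
      rw [this] at h1
      linarith
    have hexp := Real.exp_pos (-(2 * κ * L))
    calc (2 * κ * L) * (∫ x in a..b1, Real.exp (2 * R x))
        = 2 * L * (κ * ∫ x in a..b1, Real.exp (2 * R x)) := by ring
      _ ≤ 2 * L * (Real.exp (-(2 * κ * L)) * p (b1 + L)) := by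
          exact mul_le_mul_of_nonneg_left (hi.trans hii) (by positivity)
      _ = Real.exp (-(2 * κ * L)) * (2 * L * p (b1 + L)) := by ring
      _ ≤ _ := by gcongr

lemma intOn {g : ℝ → ℝ} {a K : ℝ} (hg : ContinuousOn g (Ioo (a-1) 0)) (h0 : ∀ x ≤ a, g x = 0)
    (hK : ∀ x, a ≤ x → x < 0 → |g x| ≤ K) : IntegrableOn g (Iio 0) := by
  have h1 : IntegrableOn g (Ioo (a-1) 0) := by
    refine IntegrableOn.of_bound (by simp) (hg.aestronglyMeasurable measurableSet_Ioo) (|K|) ?_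
    filter_upwards [ae_restrict_mem measurableSet_Ioo] with x hx
    rcases le_total a x with h | h
    · exact (hK x h hx.2).trans (le_abs_self K)
    · rw [h0 x h]; simp
  have h2 : IntegrableOn g (Iic a) := by
    refine (integrableOn_zero (ε' := ℝ)).congr_fun (fun x hx => (h0 x hx).symm) measurableSet_Iic
  refine (h1.union h2).mono_set fun x hx => ?_
  rcases le_total a x with h | h
  · exact Or.inl ⟨by linarith, hx⟩
  · exact Or.inr h

/-- The complex amplitude. -/
noncomputable def uu (R θ : ℝ → ℝ) (x : ℝ) : ℂ := Complex.exp ((R x : ℂ) + (θ x : ℂ) * Complex.I)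

lemma uu_normSq (R θ : ℝ → ℝ) (x : ℝ) : Complex.normSq (uu R θ x) = Real.exp (2 * R x) := by
  rw [Complex.normSq_eq_norm_sq, uu, Complex.norm_exp, ← Real.exp_nat_mul]
  simp

lemma uu_rel (R θ : ℝ → ℝ) (x : ℝ) :
    uu R (-θ) x = (Real.cos (2 * θ x) - Real.sin (2 * θ x) * Complex.I) * uu R θ x := by
  have : ((Real.cos (2 * θ x) : ℂ) - Real.sin (2 * θ x) * Complex.I)
      = Complex.exp (-(2 * θ x : ℂ) * Complex.I) := by
    rw [Complex.exp_mul_I]; push_cast; rw [Complex.cos_neg, Complex.sin_neg]; ring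
  rw [this, uu, uu, ← Complex.exp_add]
  congr 1
  simp only [Pi.neg_apply]; push_cast; ring

lemma uu_deriv {R θ : ℝ → ℝ} {x p q c : ℝ}
    (hR : HasDerivAt R (q * Real.cos (2 * θ x) + p * Real.sin (2 * θ x)) x)
    (hθ : HasDerivAt θ (c + p * Real.cos (2 * θ x) - q * Real.sin (2 * θ x)) x) :
    HasDerivAt (uu R θ) (Complex.I * c * uu R θ x + (q + Complex.I * p) * uu R (-θ) x) x := by
  have h := (hR.ofReal_comp.add (hθ.ofReal_comp.mul_const Complex.I)).cexp
  refine h.congr_deriv ?_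
  rw [uu_rel]
  simp only [uu, Pi.add_apply]
  push_cast
  linear_combination ((p * Complex.sin (2 * θ x)) * Complex.exp ((R x : ℂ) + (θ x : ℂ) * Complex.I)) * Complex.I_sq

lemma uu_deriv' {R θ : ℝ → ℝ} {x p q c : ℝ}
    (hR : HasDerivAt R (q * Real.cos (2 * θ x) + p * Real.sin (2 * θ x)) x)
    (hθ : HasDerivAt θ (c + p * Real.cos (2 * θ x) - q * Real.sin (2 * θ x)) x) :
    HasDerivAt (uu R (-θ)) (-(Complex.I * c) * uu R (-θ) x + (q - Complex.I * p) * uu R θ x) x := by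
  have := uu_deriv (R := R) (θ := -θ) (x := x) (p := -p) (q := q) (c := -c)
    (by simpa using hR) (hθ.neg.congr_deriv (by simp; ring))
  refine this.congr_deriv ?_
  simp only [neg_neg]; push_cast; ring

/-- The quasimode. -/
noncomputable def qm (N : ℝ) (χ R θ : ℝ → ℝ) (x : ℝ) : Fin 4 → ℂ :=
  ![((N * χ x : ℝ) : ℂ) * uu R θ x, ((N * χ x : ℝ) : ℂ) * uu R (-θ) x,
    -(((N * χ x : ℝ) : ℂ) * uu R (-θ) x), ((N * χ x : ℝ) : ℂ) * uu R θ x]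

lemma qm_nsq (N : ℝ) (χ R θ : ℝ → ℝ) (x : ℝ) :
    nsq (qm N χ R θ x) = 4 * N^2 * (χ x ^ 2 * Real.exp (2 * R x)) := by
  simp only [nsq, qm, Fin.sum_univ_four, Matrix.cons_val, Complex.normSq_neg, Complex.normSq_mul,
    uu_normSq, Complex.normSq_ofReal]
  ring

lemma qm_Hop {M l : ℝ} {rfun : ℝ → ℝ} {m h lam N x χ' : ℝ} (hh : 0 < h) {χ R θ : ℝ → ℝ}
    (hχ : HasDerivAt χ χ' x)
    (hR : HasDerivAt R (m * B M l rfun x * Real.cos (2 * θ x)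
      + A M l rfun x / h * Real.sin (2 * θ x)) x)
    (hθ : HasDerivAt θ (lam / h + A M l rfun x / h * Real.cos (2 * θ x)
      - m * B M l rfun x * Real.sin (2 * θ x)) x) :
    Hop M l rfun m h (qm N χ R θ) x =
      ![(((lam * N * χ x : ℝ) : ℂ) - Complex.I * ((h * N * χ' : ℝ) : ℂ)) * uu R θ x,
        (((lam * N * χ x : ℝ) : ℂ) + Complex.I * ((h * N * χ' : ℝ) : ℂ)) * uu R (-θ) x,
        -((((lam * N * χ x : ℝ) : ℂ) + Complex.I * ((h * N * χ' : ℝ) : ℂ)) * uu R (-θ) x),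
        (((lam * N * χ x : ℝ) : ℂ) - Complex.I * ((h * N * χ' : ℝ) : ℂ)) * uu R θ x] := by
  have hc : HasDerivAt (fun x => ((N * χ x : ℝ) : ℂ)) ((N * χ' : ℝ) : ℂ) x :=
    (hχ.const_mul N).ofReal_comp
  have d1 := hc.mul (uu_deriv hR hθ)
  have d2 := hc.mul (uu_deriv' hR hθ)
  have hd : HasDerivAt (qm N χ R θ)
      ![((N * χ' : ℝ) : ℂ) * uu R θ x + ((N * χ x : ℝ) : ℂ) * (Complex.I * ((lam / h : ℝ) : ℂ) * uu R θ x
          + (((m * B M l rfun x : ℝ) : ℂ) + Complex.I * ((A M l rfun x / h : ℝ) : ℂ)) * uu R (-θ) x),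
        ((N * χ' : ℝ) : ℂ) * uu R (-θ) x + ((N * χ x : ℝ) : ℂ) * (-(Complex.I * ((lam / h : ℝ) : ℂ)) * uu R (-θ) x
          + (((m * B M l rfun x : ℝ) : ℂ) - Complex.I * ((A M l rfun x / h : ℝ) : ℂ)) * uu R θ x),
        -(((N * χ' : ℝ) : ℂ) * uu R (-θ) x + ((N * χ x : ℝ) : ℂ) * (-(Complex.I * ((lam / h : ℝ) : ℂ)) * uu R (-θ) x
          + (((m * B M l rfun x : ℝ) : ℂ) - Complex.I * ((A M l rfun x / h : ℝ) : ℂ)) * uu R θ x)),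
        ((N * χ' : ℝ) : ℂ) * uu R θ x + ((N * χ x : ℝ) : ℂ) * (Complex.I * ((lam / h : ℝ) : ℂ) * uu R θ x
          + (((m * B M l rfun x : ℝ) : ℂ) + Complex.I * ((A M l rfun x / h : ℝ) : ℂ)) * uu R (-θ) x)] x := by
    rw [hasDerivAt_pi]
    intro i
    fin_cases i
    · exact d1
    · exact d2
    · exact d2.neg
    · exact d1
  have hI := Complex.I_sq
  have hne : (h : ℂ) ≠ 0 := by exact_mod_cast hh.ne'
  simp only [Hop]
  rw [hd.deriv]
  ext i
  fin_cases i <;>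
  · simp [γ01, γ02, γ0, qm]
    field_simp
    ring_nf
    simp only [Complex.I_sq]
    ring

lemma nsq_four (s t : ℝ) (R θ : ℝ → ℝ) (x : ℝ) :
    nsq ![((s : ℂ) - Complex.I * (t : ℂ)) * uu R θ x, ((s : ℂ) + Complex.I * (t : ℂ)) * uu R (-θ) x,
      -(((s : ℂ) + Complex.I * (t : ℂ)) * uu R (-θ) x), ((s : ℂ) - Complex.I * (t : ℂ)) * uu R θ x]
      = 4 * (s^2 + t^2) * Real.exp (2 * R x) := by
  have e1 : Complex.normSq ((s : ℂ) - Complex.I * (t : ℂ)) = s^2 + t^2 := by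
    simp [Complex.normSq_apply]; ring
  have e2 : Complex.normSq ((s : ℂ) + Complex.I * (t : ℂ)) = s^2 + t^2 := by
    simp [Complex.normSq_apply]; ring
  simp only [nsq, Fin.sum_univ_four, Matrix.cons_val, Complex.normSq_neg, Complex.normSq_mul,
    uu_normSq, e1, e2]
  ring

lemma qm_Hop_nsq {M l : ℝ} {rfun : ℝ → ℝ} {m h lam N x χ' : ℝ} (hh : 0 < h) {χ R θ : ℝ → ℝ}
    (hχ : HasDerivAt χ χ' x)
    (hR : HasDerivAt R (m * B M l rfun x * Real.cos (2 * θ x)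
      + A M l rfun x / h * Real.sin (2 * θ x)) x)
    (hθ : HasDerivAt θ (lam / h + A M l rfun x / h * Real.cos (2 * θ x)
      - m * B M l rfun x * Real.sin (2 * θ x)) x) :
    nsq (Hop M l rfun m h (qm N χ R θ) x)
      = 4 * N^2 * ((lam^2 * χ x ^2 + h^2 * χ'^2) * Real.exp (2 * R x)) ∧
    nsq (Hop M l rfun m h (qm N χ R θ) x - (lam : ℂ) • qm N χ R θ x)
      = 4 * N^2 * (h^2 * (χ'^2 * Real.exp (2 * R x))) := by
  have e := qm_Hop (N := N) hh hχ hR hθ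
  constructor
  · rw [e, nsq_four]; ring
  · have e2 := nsq_four 0 (h * N * χ') R θ x
    have e3 : Hop M l rfun m h (qm N χ R θ) x - (lam : ℂ) • qm N χ R θ x
        = ![(((0:ℝ) : ℂ) - Complex.I * ((h * N * χ' : ℝ) : ℂ)) * uu R θ x,
            (((0:ℝ) : ℂ) + Complex.I * ((h * N * χ' : ℝ) : ℂ)) * uu R (-θ) x,
            -((((0:ℝ) : ℂ) + Complex.I * ((h * N * χ' : ℝ) : ℂ)) * uu R (-θ) x),
            (((0:ℝ) : ℂ) - Complex.I * ((h * N * χ' : ℝ) : ℂ)) * uu R θ x] := by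
      rw [e]
      ext i
      fin_cases i <;> simp [qm] <;> ring
    rw [e3, e2]; ring

lemma uu_contDiffOn {R θ : ℝ → ℝ} {s : Set ℝ} (hR : ContDiffOn ℝ (⊤ : ℕ∞) R s)
    (hθ : ContDiffOn ℝ (⊤ : ℕ∞) θ s) : ContDiffOn ℝ (⊤ : ℕ∞) (uu R θ) s := by
  unfold uu
  exact ((Complex.ofRealCLM.contDiff.comp_contDiffOn hR).add
    ((Complex.ofRealCLM.contDiff.comp_contDiffOn hθ).mul contDiffOn_const)).cexp

lemma qm_contDiffOn {N : ℝ} {χ R θ : ℝ → ℝ} {s : Set ℝ} (hχ : ContDiff ℝ (⊤ : ℕ∞) χ)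
    (hR : ContDiffOn ℝ (⊤ : ℕ∞) R s)
    (hθ : ContDiffOn ℝ (⊤ : ℕ∞) θ s) : ContDiffOn ℝ (⊤ : ℕ∞) (qm N χ R θ) s := by
  have h1 := uu_contDiffOn hR hθ
  have h2 := uu_contDiffOn hR hθ.neg
  have h3 : ContDiffOn ℝ (⊤ : ℕ∞) (fun x => ((N * χ x : ℝ) : ℂ)) s :=
    Complex.ofRealCLM.contDiff.comp_contDiffOn (contDiffOn_const.mul hχ.contDiffOn)
  rw [contDiffOn_pi]
  intro i
  fin_cases i
  · exact h3.mul h1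
  · exact h3.mul h2
  · exact (h3.mul h2).neg
  · exact h3.mul h1

lemma assemble {M l : ℝ} {rfun : ℝ → ℝ} {m h lam a b1 L κ Kχ : ℝ} (hh : 0 < h)
    (hab : a < b1) (hL : 0 < L) (hb3 : b1 + 2 * L < 0) (hκ : 0 < κ)
    {χ χ' θ R : ℝ → ℝ} (hχs : ContDiff ℝ (⊤ : ℕ∞) χ) (hχd : ∀ x, HasDerivAt χ (χ' x) x)
    (hχc : Continuous χ')
    (hχ0 : ∀ x ≤ a, χ x = 0) (hχ1 : ∀ x, b1 ≤ x → χ x = 1) (hχb : ∀ x, |χ x| ≤ 1)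
    (hχ'b : ∀ x, |χ' x| ≤ Kχ) (hχ'0 : ∀ x ≤ a, χ' x = 0) (hχ'1 : ∀ x, b1 < x → χ' x = 0)
    (hθs : ContDiffOn ℝ (⊤ : ℕ∞) θ (Ioo (a-1) 0)) (hRs : ContDiffOn ℝ (⊤ : ℕ∞) R (Ioo (a-1) 0))
    (hR : ∀ x ∈ Ioo (a-1) 0, HasDerivAt R (m * B M l rfun x * Real.cos (2 * θ x)
      + A M l rfun x / h * Real.sin (2 * θ x)) x)
    (hθ : ∀ x ∈ Ioo (a-1) 0, HasDerivAt θ (lam / h + A M l rfun x / h * Real.cos (2 * θ x)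
      - m * B M l rfun x * Real.sin (2 * θ x)) x)
    (hK : ∃ K, ∀ x, a ≤ x → x < 0 → Real.exp (2 * R x) ≤ K)
    (hest : (2 * κ * L) * (∫ x in a..b1, Real.exp (2 * R x)) ≤ Real.exp (-(2 * κ * L)) *
        ∫ x in (b1+L)..(b1 + 2 * L), Real.exp (2 * R x)) :
    ∃ φ : ℝ → Fin 4 → ℂ,
        ContDiffOn ℝ (⊤ : ℕ∞) φ (Set.Iio 0) ∧
        (∀ x, x ≤ a → φ x = 0) ∧
        IntegrableOn (fun x => nsq (φ x)) (Set.Iio 0) ∧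
        (∫ x in Set.Iio (0:ℝ), nsq (φ x)) = 1 ∧
        IntegrableOn (fun x => nsq (Hop M l rfun m h φ x)) (Set.Iio 0) ∧
        (∫ x in Set.Iio (0:ℝ),
            nsq (Hop M l rfun m h φ x - (lam : ℂ) • φ x))
          ≤ h^2 * Kχ^2 * Real.exp (-(2 * κ * L)) / (2 * κ * L) := by
  obtain ⟨K, hK⟩ := hK
  set E : ℝ → ℝ := fun x => Real.exp (2 * R x) with hE
  have hEpos : ∀ x, 0 < E x := fun x => Real.exp_pos _
  have hEc : ContinuousOn E (Ioo (a-1) 0) := by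
    have := hRs.continuousOn
    simp only [hE]; fun_prop
  have hχcont : Continuous χ := hχs.continuous
  have hsq : ∀ {y C : ℝ}, |y| ≤ C → y^2 ≤ C^2 := fun hy => sq_le_sq' (abs_le.mp hy).1 (abs_le.mp hy).2
  have hI1 : IntegrableOn (fun x => χ x ^ 2 * E x) (Iio 0) := by
    refine intOn (a := a) (K := 1^2 * K) (by fun_prop) (fun x hx => by simp [hχ0 x hx]) fun x h1 h2 => ?_
    rw [abs_of_nonneg (mul_nonneg (sq_nonneg _) (hEpos x).le)]
    exact mul_le_mul (hsq (hχb x)) (hK x h1 h2) (hEpos x).le (by norm_num)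
  have hI2 : IntegrableOn (fun x => χ' x ^ 2 * E x) (Iio 0) := by
    refine intOn (a := a) (K := Kχ^2 * K) (by fun_prop) (fun x hx => by simp [hχ'0 x hx]) fun x h1 h2 => ?_
    rw [abs_of_nonneg (mul_nonneg (sq_nonneg _) (hEpos x).le)]
    exact mul_le_mul (hsq (hχ'b x)) (hK x h1 h2) (hEpos x).le (sq_nonneg _)
  set Z := ∫ x in Iio (0:ℝ), χ x ^ 2 * E x with hZ
  set J := ∫ x in (b1+L)..(b1 + 2 * L), E x with hJ
  have hsubJ : Icc (b1+L) (b1+2*L) ⊆ Ioo (a-1) 0 := fun x hx =>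
    ⟨by linarith [hx.1], by linarith [hx.2]⟩
  have hJpos : 0 < J := by
    refine intervalIntegral.intervalIntegral_pos_of_pos_on ?_ (fun x _ => hEpos x) (by linarith)
    refine (hEc.mono ?_).intervalIntegrable
    rwa [uIcc_of_le (by linarith)]
  have hJZ : J ≤ Z := by
    rw [hJ, intervalIntegral.integral_of_le (by linarith)]
    have hs : Ioc (b1+L) (b1+2*L) ⊆ Iio 0 := fun x hx => lt_of_le_of_lt hx.2 hb3
    calc ∫ x in Ioc (b1+L) (b1+2*L), E x = ∫ x in Ioc (b1+L) (b1+2*L), χ x ^ 2 * E x := by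
          refine setIntegral_congr_fun measurableSet_Ioc fun x hx => ?_
          simp [hχ1 x (by linarith [hx.1])]
      _ ≤ Z := setIntegral_mono_set hI1
          (Filter.Eventually.of_forall fun x => mul_nonneg (sq_nonneg _) (hEpos x).le)
          hs.eventuallyLE
  have hZpos : 0 < Z := hJpos.trans_le hJZ
  have hV : ∫ x in Iio (0:ℝ), χ' x ^ 2 * E x ≤ Kχ^2 * ∫ x in a..b1, E x := by
    have hs : Ioc a b1 ⊆ Iio 0 := fun x hx => lt_of_le_of_lt hx.2 (by linarith)
    have hEI : IntegrableOn E (Ioc a b1) := by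
      refine ((hEc.mono fun x hx => ?_).integrableOn_Icc (a := a) (b := b1)).mono_set Ioc_subset_Icc_self
      exact ⟨by linarith [hx.1], by linarith [hx.2]⟩
    rw [intervalIntegral.integral_of_le hab.le, ← integral_const_mul]
    calc ∫ x in Iio (0:ℝ), χ' x ^ 2 * E x = ∫ x in Ioc a b1, χ' x ^ 2 * E x := by
          refine (setIntegral_eq_of_subset_of_forall_sdiff_eq_zero measurableSet_Iio hs fun x hx => ?_)
          rcases le_or_gt x a with h | h
          · simp [hχ'0 x h]
          · have : b1 < x := by
              by_contra hc
              exact hx.2 ⟨h, not_lt.mp hc⟩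
            simp [hχ'1 x this]
      _ ≤ _ := by
          refine setIntegral_mono_on (hI2.mono_set hs) (hEI.const_mul _) measurableSet_Ioc fun x _ => ?_
          exact mul_le_mul_of_nonneg_right (hsq (hχ'b x)) (hEpos x).le
  set N := 1 / Real.sqrt (4 * Z) with hN
  have hN2 : 4 * N^2 * Z = 1 := by
    rw [hN, div_pow, Real.sq_sqrt (by positivity)]; field_simp
  have hzero : ∀ x ≤ a, qm N χ R θ x = 0 := by
    intro x hx
    ext i
    fin_cases i <;> simp [qm, hχ0 x hx]
  have hev : ∀ x < a, qm N χ R θ =ᶠ[nhds x] fun _ => 0 := by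
    intro x hx
    filter_upwards [Iio_mem_nhds hx] with y hy using hzero y (le_of_lt hy)
  have hform : ∀ x ∈ Iio (0:ℝ), nsq (Hop M l rfun m h (qm N χ R θ) x)
      = 4 * N^2 * ((lam^2 * χ x ^2 + h^2 * (χ' x)^2) * E x) ∧
    nsq (Hop M l rfun m h (qm N χ R θ) x - (lam : ℂ) • qm N χ R θ x)
      = 4 * N^2 * (h^2 * ((χ' x)^2 * E x)) := by
    intro x hx
    rcases lt_or_ge x a with h1 | h1
    · have hd : deriv (qm N χ R θ) x = 0 := by
        rw [(hev x h1).deriv_eq]; simp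
      have hH : Hop M l rfun m h (qm N χ R θ) x = 0 := by
        simp [Hop, hd, hzero x h1.le]
      rw [hH, hzero x h1.le, hχ0 x h1.le, hχ'0 x h1.le]
      simp [nsq]
    · have hxI : x ∈ Ioo (a-1) 0 := ⟨by linarith, hx⟩
      exact qm_Hop_nsq hh (hχd x) (hR x hxI) (hθ x hxI)
  refine ⟨qm N χ R θ, ?_, hzero, ?_, ?_, ?_, ?_⟩
  · intro x hx
    rcases lt_or_ge x a with h1 | h1
    · exact (contDiffAt_const.congr_of_eventuallyEq (hev x h1)).contDiffWithinAt
    · exact ((qm_contDiffOn hχs hRs hθs).contDiffAt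
        (isOpen_Ioo.mem_nhds ⟨by linarith, hx⟩)).contDiffWithinAt
  · simp only [qm_nsq]
    exact hI1.const_mul _
  · simp only [qm_nsq]
    rw [integral_const_mul]
    exact hN2
  · have hi : IntegrableOn (fun x => 4 * N^2 * (lam^2 * (χ x ^2 * E x) + h^2 * ((χ' x)^2 * E x)))
        (Iio 0) := ((hI1.const_mul _).add (hI2.const_mul _)).const_mul _
    refine hi.congr_fun (fun x hx => ?_) measurableSet_Iio
    simp only
    rw [(hform x hx).1]; ring
  · rw [setIntegral_congr_fun measurableSet_Iio (fun x hx => (hform x hx).2), integral_const_mul,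
      integral_const_mul]
    have hkl : 0 < 2 * κ * L := by positivity
    rw [le_div_iff₀ hkl]
    have hexp := Real.exp_pos (-(2 * κ * L))
    calc 4 * N^2 * (h^2 * ∫ x in Iio (0:ℝ), χ' x ^ 2 * E x) * (2 * κ * L)
        ≤ 4 * N^2 * (h^2 * (Kχ^2 * ∫ x in a..b1, E x)) * (2 * κ * L) := by gcongr
      _ = 4 * N^2 * (h^2 * Kχ^2) * ((2 * κ * L) * ∫ x in a..b1, E x) := by ring
      _ ≤ 4 * N^2 * (h^2 * Kχ^2) * (Real.exp (-(2 * κ * L)) * J) := by gcongr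
      _ ≤ 4 * N^2 * (h^2 * Kχ^2) * (Real.exp (-(2 * κ * L)) * Z) := by gcongr
      _ = (4 * N^2 * Z) * (h^2 * Kχ^2 * Real.exp (-(2 * κ * L))) := by ring
      _ = _ := by rw [hN2, one_mul]

lemma cutoff {a b : ℝ} (hab : a < b) : ∃ (χ χ' : ℝ → ℝ) (K : ℝ), ContDiff ℝ (⊤ : ℕ∞) χ ∧
    (∀ x, HasDerivAt χ (χ' x) x) ∧ Continuous χ' ∧ (∀ x ≤ a, χ x = 0) ∧ (∀ x, b ≤ x → χ x = 1) ∧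
    (∀ x, |χ x| ≤ 1) ∧ (∀ x, |χ' x| ≤ K) ∧ (∀ x ≤ a, χ' x = 0) ∧ (∀ x, b < x → χ' x = 0) := by
  set χ : ℝ → ℝ := fun x => Real.smoothTransition ((x - a) / (b - a)) with hχ
  have hba : 0 < b - a := by linarith
  have hs : ContDiff ℝ (⊤ : ℕ∞) χ := by
    refine (Real.smoothTransition.contDiff (n := (⊤ : ℕ∞))).comp ?_
    exact (contDiff_id.sub contDiff_const).div_const _
  have h0 : ∀ x ≤ a, χ x = 0 := fun x hx =>
    Real.smoothTransition.zero_of_nonpos (div_nonpos_of_nonpos_of_nonneg (by linarith) hba.le)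
  have h1 : ∀ x, b ≤ x → χ x = 1 := fun x hx =>
    Real.smoothTransition.one_of_one_le ((one_le_div hba).mpr (by linarith))
  have hnn : ∀ x, 0 ≤ χ x := fun x => Real.smoothTransition.nonneg _
  have hle : ∀ x, χ x ≤ 1 := fun x => Real.smoothTransition.le_one _
  have hd0 : ∀ x ≤ a, deriv χ x = 0 := fun x hx =>
    IsLocalMin.deriv_eq_zero (Filter.Eventually.of_forall fun y => by rw [h0 x hx]; exact hnn y)
  have hd1 : ∀ x, b ≤ x → deriv χ x = 0 := fun x hx =>
    IsLocalMax.deriv_eq_zero (Filter.Eventually.of_forall fun y => by rw [h1 x hx]; exact hle y)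
  have hc : Continuous (deriv χ) := hs.continuous_deriv (by simp)
  obtain ⟨K, hK⟩ := (isCompact_Icc (a := a) (b := b)).exists_bound_of_continuousOn hc.continuousOn
  refine ⟨χ, deriv χ, |K|, hs, fun x => (hs.differentiable (by simp) x).hasDerivAt, hc, h0, h1,
    fun x => ?_, fun x => ?_, hd0, fun x hx => hd1 x hx.le⟩
  · rw [abs_of_nonneg (hnn x)]; exact hle x
  · by_cases h : x ∈ Icc a b
    · exact (hK x h).trans (le_abs_self K)
    · rw [mem_Icc, not_and_or, not_le, not_le] at h
      rcases h with h | h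
      · rw [hd0 x h.le]; simp
      · rw [hd1 x h.le]; simp

lemma F_smooth (M l : ℝ) : ContDiffOn ℝ (⊤ : ℕ∞) (F M l) (Ioi 0) := by
  unfold F
  exact (contDiffOn_const.sub (contDiffOn_const.div contDiffOn_id fun x hx => ne_of_gt hx)).add
    ((contDiffOn_id.pow 2).div_const _)

lemma F_large {M l s : ℝ} (hM : 0 < M) (hs : 2 * M ≤ s) : s^2/l^2 ≤ F M l s := by
  unfold F
  have : 2 * M / s ≤ 1 := (div_le_one (by linarith)).mpr hs
  linarith

lemma Finv_int {M l rS : ℝ} (hM : 0 < M) (hl : 0 < l) (hrS : 0 < rS)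
    (hFpos : ∀ r, rS < r → 0 < F M l r) {r : ℝ} (hr : rS < r) :
    IntegrableOn (fun s => (F M l s)⁻¹) (Ioi r) := by
  have hcont : ContinuousOn (fun s => (F M l s)⁻¹) (Ioi rS) :=
    ((F_smooth M l).continuousOn.mono (Ioi_subset_Ioi hrS.le)).inv₀ fun x hx => (hFpos x hx).ne'
  set R0 := max r (2 * M) with hR0
  have hR0pos : 0 < R0 := lt_max_of_lt_right (by linarith)
  have h1 : IntegrableOn (fun s => (F M l s)⁻¹) (Icc r R0) :=
    (hcont.mono fun x hx => lt_of_lt_of_le hr hx.1).integrableOn_Icc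
  have h2 : IntegrableOn (fun s => (F M l s)⁻¹) (Ioi R0) := by
    have hb : IntegrableOn (fun s : ℝ => l^2 * s ^ (-2 : ℝ)) (Ioi R0) :=
      (integrableOn_Ioi_rpow_of_lt (by norm_num) hR0pos).const_mul _
    refine Integrable.mono' hb ?_ ?_
    · exact (hcont.mono fun x hx => lt_of_lt_of_le hr
        ((le_max_left r (2*M)).trans (le_of_lt hx))).aestronglyMeasurable measurableSet_Ioi
    · filter_upwards [ae_restrict_mem measurableSet_Ioi] with s hs
      have hs' : R0 < s := hs
      have hspos : 0 < s := hR0pos.trans hs'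
      have hF := F_large (l := l) hM ((le_max_right r (2*M)).trans hs'.le)
      have hp : 0 < s^2/l^2 := by positivity
      rw [Real.norm_of_nonneg (inv_nonneg.mpr (hp.le.trans hF))]
      calc (F M l s)⁻¹ ≤ (s^2/l^2)⁻¹ := inv_anti₀ hp hF
        _ = l^2 * s ^ (-2 : ℝ) := by
          rw [Real.rpow_neg hspos.le]
          norm_num
          field_simp
  refine (h1.union h2).mono_set fun x hx => ?_
  rcases le_or_gt x R0 with h | h
  · exact Or.inl ⟨le_of_lt hx, h⟩
  · exact Or.inr h

lemma rfun_facts {M l rS : ℝ} (hM : 0 < M) (hl : 0 < l) (hrS : 0 < rS)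
    (hFpos : ∀ r, rS < r → 0 < F M l r) {rfun : ℝ → ℝ}
    (hrange : ∀ x, x < 0 → rS < rfun x)
    (hinv1 : ∀ x, x < 0 → -(∫ s in Set.Ioi (rfun x), (F M l s)⁻¹) = x)
    (hinv2 : ∀ r, rS < r → rfun (-(∫ s in Set.Ioi r, (F M l s)⁻¹)) = r) :
    ContDiffOn ℝ (⊤ : ℕ∞) rfun (Iio 0) ∧
    ∀ K, ∃ x0, x0 < 0 ∧ ∀ x, x0 < x → x < 0 → K < rfun x := by
  have hcont : ContinuousOn (fun s => (F M l s)⁻¹) (Ioi rS) :=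
    ((F_smooth M l).continuousOn.mono (Ioi_subset_Ioi hrS.le)).inv₀ fun x hx => (hFpos x hx).ne'
  set G : ℝ → ℝ := fun r => -(∫ s in Set.Ioi r, (F M l s)⁻¹) with hG
  have hInteg : ∀ r, rS < r → IntegrableOn (fun s => (F M l s)⁻¹) (Ioi r) := fun r hr =>
    Finv_int hM hl hrS hFpos hr
  have hII : ∀ c r, rS < c → rS < r → IntervalIntegrable (fun s => (F M l s)⁻¹) volume c r := by
    intro c r hc hr
    exact (hcont.mono (ordConnected_Ioi.uIcc_subset hc hr)).intervalIntegrable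
  have hGeq : ∀ c r, rS < c → rS < r → G r = G c + ∫ s in c..r, (F M l s)⁻¹ := by
    intro c r hc hr
    have := intervalIntegral.integral_interval_add_Ioi (hInteg c hc) (hInteg r hr)
    simp only [hG]; linarith
  have hGd : ∀ r, rS < r → HasDerivAt G (F M l r)⁻¹ r := by
    intro r hr
    have h1 : HasDerivAt (fun y => G r + ∫ s in r..y, (F M l s)⁻¹) (F M l r)⁻¹ r := by
      refine HasDerivAt.const_add _ (intervalIntegral.integral_hasDerivAt_right (hII r r hr hr) ?_ ?_)
      · exact hcont.stronglyMeasurableAtFilter isOpen_Ioi r hr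
      · exact hcont.continuousAt (isOpen_Ioi.mem_nhds hr)
    refine h1.congr_of_eventuallyEq ?_
    filter_upwards [isOpen_Ioi.mem_nhds hr] with y hy using hGeq r y hr hy
  have hGpos : ∀ c r, rS < c → c < r → G c < G r := by
    intro c r hc hcr
    rw [hGeq c r hc (hc.trans hcr)]
    have : 0 < ∫ s in c..r, (F M l s)⁻¹ :=
      intervalIntegral.intervalIntegral_pos_of_pos_on (hII c r hc (hc.trans hcr))
        (fun x hx => inv_pos.mpr (hFpos x (hc.trans hx.1))) hcr
    linarith
  have hGmono : StrictMonoOn G (Ioi rS) := fun c hc r _ hcr => hGpos c r hc hcr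
  have hGneg : ∀ r, rS < r → G r < 0 := by
    intro r hr
    refine (hGpos r (r+1) hr (by linarith)).trans_le ?_
    simp only [hG]
    rw [neg_nonpos]
    refine setIntegral_nonneg measurableSet_Ioi fun x hx => ?_
    have hx' : r + 1 < x := hx
    exact (inv_pos.mpr (hFpos x (by linarith))).le
  have hrmono : StrictMonoOn rfun (Iio 0) := by
    intro x hx y hy hxy
    rw [← hGmono.lt_iff_lt (hrange x hx) (hrange y hy)]
    simp only [hG]
    rw [hinv1 x hx, hinv1 y hy]; exact hxy
  have himg : rfun '' (Iio 0) = Ioi rS := by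
    ext r
    constructor
    · rintro ⟨x, hx, rfl⟩; exact hrange x hx
    · intro hr; exact ⟨G r, hGneg r hr, hinv2 r hr⟩
  have hrd : ∀ x ∈ Iio (0:ℝ), HasDerivAt rfun (F M l (rfun x)) x := by
    intro x hx
    have hca : ContinuousAt rfun x := by
      refine hrmono.continuousAt_of_image_mem_nhds (isOpen_Iio.mem_nhds hx) ?_
      rw [himg]; exact isOpen_Ioi.mem_nhds (hrange x hx)
    have := HasDerivAt.of_local_left_inverse hca (hGd _ (hrange x hx))
      (inv_ne_zero (hFpos _ (hrange x hx)).ne')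
      (by filter_upwards [isOpen_Iio.mem_nhds hx] with y hy using hinv1 y hy)
    simpa using this
  refine ⟨smooth_of_ode isOpen_Iio hrd fun n hn => ?_, fun K => ?_⟩
  · refine ((F_smooth M l).of_le (by exact_mod_cast le_top)).comp hn fun x hx => ?_
    exact hrS.trans (hrange x hx)
  · have hK : rS < max K (rS + 1) := lt_max_of_lt_right (by linarith)
    refine ⟨G (max K (rS+1)), hGneg _ hK, fun x h1 h2 => ?_⟩
    have := hrmono (hGneg _ hK) h2 h1
    simp only [hG] at this
    rw [hinv2 _ hK] at this
    exact (le_max_left _ _).trans_lt this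

end Aux18

open Aux18

set_option maxHeartbeats 4000000

/-- Existence of exponentially accurate quasimodes for the Dirac operator. -/
theorem stmt_18 (M l : ℝ) (hM : 0 < M) (hl : 0 < l)
    (rSAdS : ℝ) (hrS : 0 < rSAdS) (hroot : F M l rSAdS = 0)
    (hFpos : ∀ r, rSAdS < r → 0 < F M l r)
    (rfun : ℝ → ℝ)
    (hrange : ∀ x, x < 0 → rSAdS < rfun x)
    (hinv1 : ∀ x, x < 0 → -(∫ s in Set.Ioi (rfun x), (F M l s)⁻¹) = x)
    (hinv2 : ∀ r, rSAdS < r → rfun (-(∫ s in Set.Ioi r, (F M l s)⁻¹)) = r)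
    (m : ℝ) (hm : 0 < m) (hml : 1 < m*l)
    (xp : ℝ) (hxp : xp < 0)
    (hA' : ∀ x, xp ≤ x → x < 0 → deriv (A M l rfun) x < 0)
    (hcond : ∀ r, rfun xp ≤ r → 0 ≤ F M l r / (4*l^2) - (F' M l r)^2 / 16)
    (S : ℝ) (hS : 0 < S) (hSA : 1/l^2 + S < (A M l rfun xp)^2) :
    ∃ h₀ > 0, ∃ D > 0, ∀ h : ℝ, 0 < h → h < h₀ →
      ∃ E : ℝ, 0 < E ∧ E < 1/l^2 + S ∧
      ∃ φ : ℝ → Fin 4 → ℂ,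
        ContDiffOn ℝ (⊤ : ℕ∞) φ (Set.Iio 0) ∧
        (∀ x, x ≤ xp → φ x = 0) ∧
        IntegrableOn (fun x => nsq (φ x)) (Set.Iio 0) ∧
        (∫ x in Set.Iio (0:ℝ), nsq (φ x)) = 1 ∧
        IntegrableOn (fun x => nsq (Hop M l rfun m h φ x)) (Set.Iio 0) ∧
        Real.sqrt (∫ x in Set.Iio (0:ℝ),
            nsq (Hop M l rfun m h φ x - ((Real.sqrt E : ℝ) : ℂ) • φ x))
          ≤ Real.exp (-D/h) := by
  obtain ⟨hrs, hrinf⟩ := rfun_facts hM hl hrS hFpos hrange hinv1 hinv2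
  have hrpos : ∀ x, x < 0 → 0 < rfun x := fun x hx => hrS.trans (hrange x hx)
  have hFr : ∀ x, x < 0 → 0 < F M l (rfun x) := fun x hx => hFpos _ (hrange x hx)
  have hFs : ContDiffOn ℝ (⊤ : ℕ∞) (fun x => F M l (rfun x)) (Iio 0) :=
    (F_smooth M l).comp hrs fun x hx => hrpos x hx
  have hBs : ContDiffOn ℝ (⊤ : ℕ∞) (B M l rfun) (Iio 0) := hFs.sqrt fun x hx => (hFr x hx).ne'
  have hAs : ContDiffOn ℝ (⊤ : ℕ∞) (A M l rfun) (Iio 0) := hBs.div hrs fun x hx => (hrpos x hx).ne'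
  have hApos : ∀ x, x < 0 → 0 < A M l rfun x := fun x hx =>
    div_pos (Real.sqrt_pos.mpr (hFr x hx)) (hrpos x hx)
  have hBnn : ∀ x, 0 ≤ B M l rfun x := fun x => Real.sqrt_nonneg _
  have hAsq : ∀ x, x < 0 → (A M l rfun x)^2 = F M l (rfun x) / (rfun x)^2 := fun x hx => by
    rw [A, div_pow, Real.sq_sqrt (hFr x hx).le]
  -- strict monotonicity of `A`
  have hAanti : ∀ x y, xp ≤ x → x < y → y < 0 → A M l rfun y < A M l rfun x := by
    intro x y hx hxy hy
    have hs : Icc x y ⊆ Iio 0 := fun z hz => lt_of_le_of_lt hz.2 hy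
    refine strictAntiOn_of_deriv_neg (convex_Icc x y) (hAs.continuousOn.mono hs) (fun z hz => ?_)
      ⟨le_rfl, hxy.le⟩ ⟨hxy.le, le_rfl⟩ hxy
    have hz' := interior_subset hz
    exact hA' z (hx.trans hz'.1) (hs hz')
  set α := 1 / l with hα
  have hαpos : 0 < α := by positivity
  have hα2 : α^2 = 1/l^2 := by rw [hα, div_pow, one_pow]
  -- the limit of `A` at zero
  have hAge : ∃ z0, z0 < 0 ∧ ∀ z, z0 < z → z < 0 → α ≤ A M l rfun z := by
    obtain ⟨z0, hz0, h⟩ := hrinf (2 * M)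
    refine ⟨z0, hz0, fun z h1 h2 => ?_⟩
    have h3 := F_large (l := l) hM (h z h1 h2).le
    refine le_of_sq_le_sq ?_ (hApos z h2).le
    rw [hAsq z h2, hα2, le_div_iff₀ (pow_pos (hrpos z h2) 2)]
    calc 1 / l^2 * (rfun z)^2 = (rfun z)^2 / l^2 := by ring
      _ ≤ _ := h3
  have hAgt : ∀ x, xp ≤ x → x < 0 → α < A M l rfun x := by
    intro x hx hx0
    obtain ⟨z0, hz0, h⟩ := hAge
    have hm1 := le_max_left x z0
    have hm2 := le_max_right x z0
    have hm3 : max x z0 < 0 := max_lt hx0 hz0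
    have h1 := h (max x z0 / 2) (by linarith) (by linarith)
    have h2 := hAanti x (max x z0 / 2) hx (by linarith) (by linarith)
    linarith
  have hAlt : ∀ lam, α < lam → ∃ y, xp < y ∧ y < 0 ∧ A M l rfun y < lam := by
    intro lam hlam
    have hd : 0 < lam^2 - α^2 := by nlinarith
    obtain ⟨z0, hz0, h⟩ := hrinf (max 1 (1 / (lam^2 - α^2)))
    have hm1 := le_max_left xp z0
    have hm2 := le_max_right xp z0
    have hm3 : max xp z0 < 0 := max_lt hxp hz0
    refine ⟨max xp z0 / 2, by linarith, by linarith, ?_⟩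
    set y := max xp z0 / 2 with hy
    have hy0 : y < 0 := by linarith
    have h1 := h y (by linarith) hy0
    have h2 : 1 < rfun y := (le_max_left _ _).trans_lt h1
    have h3 : 1 / (lam^2 - α^2) < rfun y := (le_max_right _ _).trans_lt h1
    have h4 : 1 < rfun y * (lam^2 - α^2) := (div_lt_iff₀ hd).mp h3
    refine lt_of_pow_lt_pow_left₀ 2 (by linarith) ?_
    rw [hAsq y hy0, div_lt_iff₀ (pow_pos (hrpos y hy0) 2)]
    have h5 : F M l (rfun y) < 1 + α^2 * (rfun y)^2 := by
      unfold F
      have : 0 < 2 * M / rfun y := by have := hrpos y hy0; positivity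
      rw [hα2]
      have e : 1 / l^2 * (rfun y)^2 = (rfun y)^2 / l^2 := by ring
      linarith
    nlinarith
  -- divergence of `B` at zero
  have hBinf : ∀ K, ∃ x0, xp ≤ x0 ∧ x0 < 0 ∧ ∀ x, x0 ≤ x → x < 0 → K < m * B M l rfun x := by
    intro K
    obtain ⟨z0, hz0, h⟩ := hrinf (max (2 * M) (K * l / m))
    have hm1 := le_max_left xp z0
    have hm2 := le_max_right xp z0
    have hm3 : max xp z0 < 0 := max_lt hxp hz0
    refine ⟨max xp z0 / 2, by linarith, by linarith, fun x h1 h2 => ?_⟩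
    have h3 := h x (by linarith) h2
    have h4 := F_large (l := l) hM ((le_max_left _ _).trans h3.le)
    have h5 : K * l / m < rfun x := (le_max_right _ _).trans_lt h3
    have h6 : rfun x / l ≤ B M l rfun x := by
      refine Real.le_sqrt_of_sq_le ?_
      rw [div_pow]; exact h4
    have h7 : K * l < rfun x * m := (div_lt_iff₀ hm).mp h5
    have h8 : K < rfun x / l * m := by
      rw [div_mul_eq_mul_div, lt_div_iff₀ hl]; exact h7
    nlinarith
  -- the energy window
  set μ := Real.sqrt (1/l^2 + S/2) with hμ
  have hμ2 : μ^2 = 1/l^2 + S/2 := Real.sq_sqrt (by positivity)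
  have hμ0 : 0 ≤ μ := Real.sqrt_nonneg _
  have hαμ : α < μ := lt_of_pow_lt_pow_left₀ 2 hμ0 (by rw [hα2, hμ2]; linarith)
  have hμA : μ < A M l rfun xp :=
    lt_of_pow_lt_pow_left₀ 2 (hApos xp hxp).le (by rw [hμ2]; linarith)
  -- the forbidden region
  set δ := (A M l rfun xp - μ) / 2 with hδ
  have hδpos : 0 < δ := by rw [hδ]; linarith
  obtain ⟨y, hxy, hy0, hAy⟩ : ∃ y, xp < y ∧ y < 0 ∧ μ + δ < A M l rfun y := by
    have hc : ContinuousAt (A M l rfun) xp := hAs.continuousOn.continuousAt (isOpen_Iio.mem_nhds hxp)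
    have h1 : ∀ᶠ z in nhds xp, μ + δ < A M l rfun z :=
      hc.eventually_const_lt (by rw [hδ]; linarith)
    have h2 : ∀ᶠ z in nhdsWithin xp (Ioi xp), μ + δ < A M l rfun z := h1.filter_mono nhdsWithin_le_nhds
    have h3 : ∀ᶠ z in nhdsWithin xp (Ioi xp), z ∈ Ioo xp 0 := Ioo_mem_nhdsGT hxp
    obtain ⟨z, hz1, hz2⟩ := (h2.and h3).exists
    exact ⟨z, hz2.1, hz2.2, hz1⟩
  have hAforb : ∀ x, xp ≤ x → x ≤ y → μ + δ ≤ A M l rfun x := by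
    intro x h1 h2
    rcases h2.eq_or_lt with h | h
    · rw [h]; exact hAy.le
    · exact hAy.le.trans (hAanti x y h1 h hy0).le
  set L := (y - xp) / 3 with hL
  have hLpos : 0 < L := by rw [hL]; linarith
  set b1 := xp + L with hb1
  have hb3 : b1 + 2 * L = y := by rw [hb1, hL]; ring
  obtain ⟨χ, χ', Kχ, hχs, hχd, hχc, hχ0, hχ1, hχb, hχ'b, hχ'0, hχ'1⟩ :=
    cutoff (a := xp) (b := b1) (by rw [hb1]; linarith)
  -- the oscillation region
  set δ' := (μ - α) / 2 with hδ'
  have hδ'pos : 0 < δ' := by rw [hδ']; linarith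
  obtain ⟨y1, hxy1, hy10, hAy1⟩ := hAlt (μ - δ') (by rw [hδ']; linarith)
  set y2 := y1 / 2 with hy2
  have hy12 : y1 < y2 := by rw [hy2]; linarith
  have hy20 : y2 < 0 := by rw [hy2]; linarith
  have hAosc : ∀ x ∈ Icc y1 y2, A M l rfun x ≤ μ - δ' := by
    intro x hx
    rcases hx.1.eq_or_lt with h | h
    · rw [← h]; exact hAy1.le
    · exact (hAanti y1 x hxy1.le h (lt_of_le_of_lt hx.2 hy20)).le.trans hAy1.le
  have hQs : ContDiffOn ℝ (⊤ : ℕ∞) (fun x => m * B M l rfun x) (Iio 0) := contDiffOn_const.mul hBs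
  obtain ⟨KB, hKB⟩ := exists_bound hQs.continuousOn hQs.continuousOn (y := y1) hy20
  set T : ℝ := KB + Real.pi / (y2 - y1) with hT
  have hTpos : 0 < T := by
    have h1 : (0:ℝ) ≤ KB := KB.2
    have h2 : 0 < Real.pi / (y2 - y1) := div_pos Real.pi_pos (by linarith)
    rw [hT]; linarith
  refine ⟨min 1 (min (δ' / T) (2 * δ * L / (Kχ^2 + 1))), ?_, δ * L / 2, by positivity, ?_⟩
  · refine lt_min one_pos (lt_min (by positivity) (by positivity))
  intro h hh hh0
  have hh1 : h < 1 := hh0.trans_le (min_le_left _ _)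
  have hh2 : h < δ' / T := hh0.trans_le ((min_le_right _ _).trans (min_le_left _ _))
  have hh3 : h < 2 * δ * L / (Kχ^2 + 1) := hh0.trans_le ((min_le_right _ _).trans (min_le_right _ _))
  have hPs : ContDiffOn ℝ (⊤ : ℕ∞) (fun x => A M l rfun x / h) (Iio 0) := hAs.div_const _
  obtain ⟨c, θ, hc0, hc1, hsol, hθb, hθ0⟩ := shooting (P := fun x => A M l rfun x / h)
    (Q := fun x => m * B M l rfun x) hPs.continuousOn hQs.continuousOn
    (a := xp) (c0 := α / h) (c1 := μ / h) hxp (by positivity) (by gcongr)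
    (fun x z h1 h2 h3 => div_lt_div_of_pos_right (hAanti x z h1 h2 h3) hh)
    (fun x h1 h2 => div_lt_div_of_pos_right (hAgt x h1 h2) hh)
    (hBinf _) (y1 := y1) (y2 := y2) (η := δ' / h - KB) hxy1.le hy12.le hy20
    (fun x hx => by
      have e1 := (hKB x hx).1
      have e2 : A M l rfun x / h ≤ (μ - δ') / h := div_le_div_of_nonneg_right (hAosc x hx) hh.le
      have e3 : (μ - δ') / h = μ / h - δ' / h := by ring
      linarith)
    (by
      have e1 : T < δ' / h := by
        rw [lt_div_iff₀ hh]
        have := (lt_div_iff₀ hTpos).mp hh2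
        linarith
      have e2 : Real.pi / (y2 - y1) < δ' / h - KB := by rw [hT] at e1; linarith
      have e3 := (div_lt_iff₀ (by linarith : 0 < y2 - y1)).mp e2
      linarith [Real.pi_pos])
  set lam := c * h with hlam
  have hcl : c = lam / h := by rw [hlam]; field_simp
  have hl0 : α ≤ lam := by rw [hlam]; exact (div_le_iff₀ hh).mp hc0
  have hl1 : lam ≤ μ := by rw [hlam]; exact (le_div_iff₀ hh).mp hc1
  have hlpos : 0 < lam := hαpos.trans_le hl0
  have hκ : 0 < δ / h := by positivity
  obtain ⟨R, hθs, hRs, hRd, hRb, hest⟩ := core hPs hQs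
    (fun x _ => mul_nonneg hm.le (hBnn x)) hxp hsol (KP := A M l rfun xp / h)
    (fun x h1 h2 => ⟨(div_pos (hApos x h2) hh).le, by
      refine div_le_div_of_nonneg_right ?_ hh.le
      rcases h1.eq_or_lt with h | h
      · rw [h]
      · exact (hAanti xp x le_rfl h h2).le⟩)
    hθb hθ0 (b1 := b1) (L := L) (κ := δ / h) (by rw [hb1]; linarith) hLpos (by rw [hb3]; exact hy0)
    hκ (by rw [hcl]; positivity) (fun x h1 h2 => by
      rw [hb3] at h2
      have e := hAforb x h1 h2
      rw [hcl, ← add_div]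
      exact div_le_div_of_nonneg_right (by linarith) hh.le)
  obtain ⟨φ, g1, g2, g3, g4, g5, g6⟩ := assemble (M := M) (l := l) (rfun := rfun) (m := m) (h := h)
    (lam := lam) (a := xp) (b1 := b1) (L := L) (κ := δ / h) (Kχ := Kχ) hh (by rw [hb1]; linarith)
    hLpos (by rw [hb3]; exact hy0) hκ hχs hχd hχc hχ0 hχ1 hχb hχ'b hχ'0 hχ'1 hθs hRs hRd
    (fun x hx => by have := hsol.2 x hx; rw [hcl] at this; exact this) hRb hest
  have hsq : Real.sqrt (lam^2) = lam := Real.sqrt_sq hlpos.le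
  refine ⟨lam^2, by positivity, ?_, φ, g1, g2, g3, g4, g5, ?_⟩
  · have : lam^2 ≤ μ^2 := by gcongr
    linarith
  · rw [hsq]
    refine Real.sqrt_le_iff.mpr ⟨(Real.exp_pos _).le, g6.trans ?_⟩
    set w := δ * L / h with hw
    have hwpos : 0 < w := by positivity
    have e1 : 2 * (δ / h) * L = 2 * w := by rw [hw]; ring
    have e2 : Real.exp (-(δ * L / 2) / h) ^ 2 = Real.exp (-w) := by
      rw [← Real.exp_nat_mul, hw]; congr 1; push_cast; ring
    have e3 : Real.exp (-(2 * w)) = Real.exp (-w) * Real.exp (-w) := by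
      rw [← Real.exp_add]; congr 1; ring
    rw [e1, e2, e3, div_le_iff₀ (by positivity)]
    have e4 : h^2 * Kχ^2 ≤ 2 * w := by
      have k1 := (lt_div_iff₀ (by positivity : 0 < Kχ^2 + 1)).mp hh3
      have k2 : 2 * w = 2 * δ * L / h := by rw [hw]; ring
      rw [k2, le_div_iff₀ hh]
      have k3 : h * Kχ^2 ≤ 2 * δ * L := by nlinarith
      have k4 : 0 ≤ h * Kχ^2 := by positivity
      have k5 : h^2 ≤ 1 := by nlinarith
      calc h^2 * Kχ^2 * h = h^2 * (h * Kχ^2) := by ring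
        _ ≤ 1 * (h * Kχ^2) := by gcongr
        _ ≤ _ := by linarith
    have e5 : Real.exp (-w) ≤ 1 := Real.exp_le_one_iff.mpr (by linarith)
    have e6 := Real.exp_pos (-w)
    calc h^2 * Kχ^2 * (Real.exp (-w) * Real.exp (-w))
        ≤ (2 * w) * (Real.exp (-w) * 1) := by gcongr
      _ = _ := by ring
end
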